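/- Let (N_k)_{k≥1} be an increasing sequence of positive integers with S_{N_k}^{(A_r)} ≠ ∅ for all k and all r∈[s]. For every n ≥ 1 and all words w_1,…,w_n ∈ 𝔽, the limit as k → ∞ of E_k[ Π_{a=1}^n tr U_{w_a}(σ) ] equals 1 if w_a ≈ e for all a∈[n], and equals 0 otherwise. Moreover, if in addition each of the sets A_1,…,A_s either is a singleton or is infinite, and it is not the case that w_a ≈ e for all a, then E_k[ Π_{a=1}^n tr U_{w_a}(σ) ] = O(1/N_k) as k → ∞. -/

import Mathlib

noncomputable section

open Filter Topology

/-- `permSet A N` is `S_N^(A)`: the set of permutations of `{1,…,N}` (modeled as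
`Fin N`) all of whose cycles have length belonging to `A`; the length of the cycle
of `σ` containing `i` is the minimal period of `i` under `σ`. -/
def permSet (A : Set ℕ) (N : ℕ) : Set (Equiv.Perm (Fin N)) :=
  {σ | ∀ i : Fin N, Function.minimalPeriod (⇑σ) i ∈ A}

/-- `pN A k N` is `p_N^(A)(k)`: the probability that, in a uniformly random
permutation from `S_N^(A)`, the first element belongs to a cycle of length `k`. -/
def pN (A : Set ℕ) (k N : ℕ) : ℝ :=
  (Nat.card {σ : Equiv.Perm (Fin N) // σ ∈ permSet A N ∧
      ∃ i : Fin N, (i : ℕ) = 0 ∧ Function.minimalPeriod (⇑σ) i = k} : ℝ) /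
    (Nat.card ↥(permSet A N) : ℝ)

/-- The permutation matrix of `σ`: `(M_σ)_{i,j} = 1` iff `σ(j) = i`. -/
def permMat (N : ℕ) (σ : Equiv.Perm (Fin N)) : Matrix (Fin N) (Fin N) ℂ :=
  Matrix.of fun i j => if σ j = i then 1 else 0

/-- The normalized trace of an `N × N` matrix. -/
def ntr {N : ℕ} (M : Matrix (Fin N) (Fin N) ℂ) : ℂ := Matrix.trace M / (N : ℂ)

/-- `Uword N σ w` is the matrix obtained from the word `w` by replacing each letter
`g_r` (encoded `(r, true)`) by `M_{σ_r}` and each `g_r^*` (encoded `(r, false)`) by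
`M_{σ_r}^* = M_{σ_r⁻¹}`, and multiplying; the empty word gives the identity. -/
def Uword {s : ℕ} (N : ℕ) (σ : Fin s → Equiv.Perm (Fin N))
    (w : List (Fin s × Bool)) : Matrix (Fin N) (Fin N) ℂ :=
  (w.map fun p => if p.2 then permMat N (σ p.1) else permMat N ((σ p.1)⁻¹)).prod

/-- `EE A N h` is the average of `h(σ₁,…,σ_s)` over all tuples
`(σ₁,…,σ_s) ∈ S_N^{(A_1)} × ⋯ × S_N^{(A_s)}`. -/
def EE {s : ℕ} (A : Fin s → Set ℕ) (N : ℕ)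
    (h : (Fin s → Equiv.Perm (Fin N)) → ℂ) : ℂ :=
  (∑ᶠ σ : {σ : Fin s → Equiv.Perm (Fin N) // ∀ r, σ r ∈ permSet (A r) N}, h σ.1) /
    ∏ r : Fin s, (Nat.card ↥(permSet (A r) N) : ℂ)

/-- The defining relations of the congruence `≈`. -/
inductive WordRel (s : ℕ) (d : Fin s → ℕ∞) :
    List (Fin s × Bool) → List (Fin s × Bool) → Prop
  | cancel₁ (r : Fin s) : WordRel s d [(r, true), (r, false)] []
  | cancel₂ (r : Fin s) : WordRel s d [(r, false), (r, true)] []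
  | power₁ (r : Fin s) (m : ℕ) (h : d r = (m : ℕ∞)) :
      WordRel s d (List.replicate m (r, true)) []
  | power₂ (r : Fin s) (m : ℕ) (h : d r = (m : ℕ∞)) :
      WordRel s d (List.replicate m (r, false)) []

/-- The monoid congruence `≈` on the free monoid on the letters `g_r` (encoded
`(r, true)`) and `g_r^*` (encoded `(r, false)`), generated by the relations
`g_r g_r^* ≈ g_r^* g_r ≈ e` and (for `d_r < ∞`) `g_r^{d_r} ≈ (g_r^*)^{d_r} ≈ e`. -/
inductive WordEquiv (s : ℕ) (d : Fin s → ℕ∞) :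
    List (Fin s × Bool) → List (Fin s × Bool) → Prop
  | of {w₁ w₂} : WordRel s d w₁ w₂ → WordEquiv s d w₁ w₂
  | refl (w) : WordEquiv s d w w
  | symm {w₁ w₂} : WordEquiv s d w₁ w₂ → WordEquiv s d w₂ w₁
  | trans {w₁ w₂ w₃} : WordEquiv s d w₁ w₂ → WordEquiv s d w₂ w₃ → WordEquiv s d w₁ w₃
  | mul {w₁ w₂ v₁ v₂} : WordEquiv s d w₁ w₂ → WordEquiv s d v₁ v₂ →
      WordEquiv s d (w₁ ++ v₁) (w₂ ++ v₂)



section explore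
variable {ι α : Type*} [Fintype ι] [DecidableEq ι] [Fintype α] [DecidableEq α]

/-- tuples of permutations agreeing with the revealed triples -/
def Tset (P : Finset (ι × α × α)) : Finset (ι → Equiv.Perm α) :=
  Finset.univ.filter fun τ => ∀ q ∈ P, τ q.1 q.2.1 = q.2.2

lemma mem_Tset {P : Finset (ι × α × α)} {τ : ι → Equiv.Perm α} :
    τ ∈ Tset P ↔ ∀ q ∈ P, τ q.1 q.2.1 = q.2.2 := by
  simp [Tset]

lemma Tset_card_le_swap (P : Finset (ι × α × α)) (r : ι) (z y y' : α)
    (hz : ∀ q ∈ P, q.1 = r → q.2.1 ≠ z)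
    (hy : ∀ q ∈ P, q.1 = r → q.2.2 ≠ y) (hy' : ∀ q ∈ P, q.1 = r → q.2.2 ≠ y') :
    (Tset (insert (r, z, y) P)).card ≤ (Tset (insert (r, z, y') P)).card := by
  refine Finset.card_le_card_of_injOn
    (fun τ => Function.update τ r (Equiv.swap y y' * τ r)) ?_ ?_
  · intro τ hτ
    have hτ' := mem_Tset.1 (Finset.mem_coe.1 hτ)
    refine Finset.mem_coe.2 (mem_Tset.2 ?_)
    intro q hq
    rcases Finset.mem_insert.1 hq with rfl | hq
    · have := hτ' (r, z, y) (Finset.mem_insert_self _ _)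
      simp at this
      simp [this]
    · have h1 := hτ' q (Finset.mem_insert_of_mem hq)
      by_cases hr : q.1 = r
      · have h2 := hy q hq hr
        have h3 := hy' q hq hr
        subst hr
        simp [h1, Equiv.swap_apply_of_ne_of_ne h2 h3]
      · simp [hr, h1]
  · intro τ _ τ' _ h
    funext i
    have := congrFun h i
    by_cases hr : i = r
    · subst hr
      simpa using this
    · simpa [hr] using this

lemma Tset_filter_card (P : Finset (ι × α × α)) (r : ι) (z : α)
    (E : (ι → Equiv.Perm α) → Prop) [DecidablePred E] :
    ((Tset P).filter E).card = ∑ y, ((Tset (insert (r, z, y) P)).filter E).card := by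
  rw [Finset.card_eq_sum_card_fiberwise (f := fun τ => τ r z) (t := Finset.univ)
    (fun _ _ => Finset.mem_coe.2 (Finset.mem_univ _))]
  refine Finset.sum_congr rfl fun y _ => ?_
  congr 1
  ext τ
  simp only [Finset.mem_filter, mem_Tset, Finset.forall_mem_insert]
  tauto

lemma Tset_step_card (P : Finset (ι × α × α)) (r : ι) (z y : α)
    (hz : ∀ q ∈ P, q.1 = r → q.2.1 ≠ z) :
    (Tset (insert (r, z, y) P)).card * (Fintype.card α - P.card) ≤ (Tset P).card := by
  by_cases hy : ∀ q ∈ P, q.1 = r → q.2.2 ≠ y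
  · have h := Tset_filter_card P r z (fun _ => True)
    simp only [Finset.filter_true] at h
    rw [h]
    set S : Finset α := Finset.univ \ (P.image fun q => q.2.2) with hS
    have hc : Fintype.card α - P.card ≤ S.card := by
      rw [hS, Finset.card_sdiff_of_subset (Finset.subset_univ _), Finset.card_univ]
      have : (P.image fun q => q.2.2).card ≤ P.card := Finset.card_image_le
      omega
    calc (Tset (insert (r, z, y) P)).card * (Fintype.card α - P.card)
        ≤ (Tset (insert (r, z, y) P)).card * S.card := Nat.mul_le_mul_left _ hc
      _ = ∑ y' ∈ S, (Tset (insert (r, z, y) P)).card := by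
          rw [Finset.sum_const, smul_eq_mul, mul_comm]
      _ ≤ ∑ y' ∈ S, (Tset (insert (r, z, y') P)).card := by
          refine Finset.sum_le_sum fun y' hy' => ?_
          refine Tset_card_le_swap P r z y y' hz hy ?_
          intro q hq _ h
          simp only [hS, Finset.mem_sdiff, Finset.mem_univ, true_and, Finset.mem_image,
            not_exists, not_and] at hy'
          exact hy' q hq h
      _ ≤ _ := Finset.sum_le_sum_of_subset (Finset.subset_univ _)
  · push Not at hy
    obtain ⟨q, hq, hr, hqy⟩ := hy
    have : Tset (insert (r, z, y) P) = ∅ := by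
      rw [Finset.eq_empty_iff_forall_notMem]
      intro τ hτ
      rw [mem_Tset] at hτ
      have h1 := hτ _ (Finset.mem_insert_self _ _)
      have h2 := hτ q (Finset.mem_insert_of_mem hq)
      have h3 := hz q hq hr
      simp only at h1
      rw [hr, hqy, ← h1] at h2
      exact h3 ((τ r).injective h2)
    simp [this]

lemma explore_fwd (P : Finset (ι × α × α)) (r : ι) (z : α)
    (hz : ∀ q ∈ P, q.1 = r → q.2.1 ≠ z)
    (E : (ι → Equiv.Perm α) → Prop) [DecidablePred E] (B : Finset α) (b : ℝ) (hb : 0 ≤ b)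
    (hP : 2 * P.card ≤ Fintype.card α) (hN : 0 < Fintype.card α)
    (h : ∀ y ∉ B, (((Tset (insert (r, z, y) P)).filter E).card : ℝ) ≤
      b * (Tset (insert (r, z, y) P)).card) :
    (((Tset P).filter E).card : ℝ) ≤
      (2 * B.card / Fintype.card α + b) * (Tset P).card := by
  have hN' : (0 : ℝ) < Fintype.card α := by exact_mod_cast hN
  have h0 := Tset_filter_card P r z (fun _ => True)
  simp only [Finset.filter_true] at h0
  have key : ∀ y, (((Tset (insert (r, z, y) P)).filter E).card : ℝ) ≤
      (if y ∈ B then (2 / Fintype.card α : ℝ) * (Tset P).card else 0) +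
      b * (Tset (insert (r, z, y) P)).card := by
    intro y
    split_ifs with hy
    · have h1 := Tset_step_card P r z y hz
      have h2 : ((Tset (insert (r, z, y) P)).card : ℝ) * (Fintype.card α - P.card) ≤
          (Tset P).card := by
        have : (((Fintype.card α - P.card : ℕ)) : ℝ) = Fintype.card α - P.card :=
          Nat.cast_sub (by omega)
        rw [← this]
        exact_mod_cast h1
      have h3 : (((Tset (insert (r, z, y) P)).filter E).card : ℝ) ≤
          (Tset (insert (r, z, y) P)).card := by
        exact_mod_cast Finset.card_filter_le _ _
      have h4 : (2 : ℝ) * P.card ≤ Fintype.card α := by exact_mod_cast hP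
      have h5 : ((Tset (insert (r, z, y) P)).card : ℝ) ≤
          (2 / Fintype.card α : ℝ) * (Tset P).card := by
        rw [div_mul_eq_mul_div, le_div_iff₀ hN']
        nlinarith [Nat.cast_nonneg (α := ℝ) (Tset (insert (r, z, y) P)).card]
      have : 0 ≤ b * ((Tset (insert (r, z, y) P)).card : ℝ) := by positivity
      linarith
    · simpa using h y hy
  rw [Tset_filter_card P r z E]
  push_cast
  refine (Finset.sum_le_sum fun y _ => key y).trans ?_
  rw [Finset.sum_add_distrib, ← Finset.mul_sum, ← Nat.cast_sum, ← h0, Finset.sum_ite_mem]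
  simp only [Finset.univ_inter, Finset.sum_const, nsmul_eq_mul]
  apply le_of_eq
  ring

/-- swap the two sides of the revealed triples -/
def swp (P : Finset (ι × α × α)) : Finset (ι × α × α) :=
  P.image fun q => (q.1, q.2.2, q.2.1)

lemma Tset_swp (P : Finset (ι × α × α)) (E : (ι → Equiv.Perm α) → Prop) [DecidablePred E] :
    ((Tset (swp P)).filter (fun τ => E τ⁻¹)).card = ((Tset P).filter E).card := by
  refine Finset.card_bij (fun τ _ => τ⁻¹) ?_ ?_ ?_
  · intro τ hτ
    simp only [Finset.mem_filter, mem_Tset, swp, Finset.forall_mem_image] at hτ ⊢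
    refine ⟨fun q hq => ?_, hτ.2⟩
    have := hτ.1 hq
    rw [Pi.inv_apply, Equiv.Perm.inv_eq_iff_eq, this]
  · intro a _ b _ h
    exact inv_injective h
  · intro τ hτ
    refine ⟨τ⁻¹, ?_, inv_inv _⟩
    simp only [Finset.mem_filter, mem_Tset, swp, Finset.forall_mem_image, inv_inv] at hτ ⊢
    refine ⟨fun q hq => ?_, hτ.2⟩
    have := hτ.1 q hq
    simp only [Pi.inv_apply]
    rw [Equiv.Perm.inv_eq_iff_eq, this]

lemma Tset_swp' (P : Finset (ι × α × α)) : (Tset (swp P)).card = (Tset P).card := by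
  simpa using Tset_swp P (fun _ => True)

lemma swp_insert (P : Finset (ι × α × α)) (r : ι) (z y : α) :
    swp (insert (r, z, y) P) = insert (r, y, z) (swp P) := by
  simp [swp, Finset.image_insert]

lemma explore_bwd (P : Finset (ι × α × α)) (r : ι) (y : α)
    (hy : ∀ q ∈ P, q.1 = r → q.2.2 ≠ y)
    (E : (ι → Equiv.Perm α) → Prop) [DecidablePred E] (B : Finset α) (b : ℝ) (hb : 0 ≤ b)
    (hP : 2 * P.card ≤ Fintype.card α) (hN : 0 < Fintype.card α)
    (h : ∀ z ∉ B, (((Tset (insert (r, z, y) P)).filter E).card : ℝ) ≤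
      b * (Tset (insert (r, z, y) P)).card) :
    (((Tset P).filter E).card : ℝ) ≤
      (2 * B.card / Fintype.card α + b) * (Tset P).card := by
  have hc : (swp P).card ≤ P.card := Finset.card_image_le
  rw [← Tset_swp, ← Tset_swp' P]
  refine explore_fwd (swp P) r y ?_ (fun τ => E τ⁻¹) B b hb (by omega) hN ?_
  · simp only [swp, Finset.forall_mem_image]
    intro q hq
    exact hy q hq
  · intro z hz
    rw [← swp_insert, Tset_swp, Tset_swp']
    exact h z hz

/-- conjugate tuple -/
def conjT (τ σ : ι → Equiv.Perm α) : ι → Equiv.Perm α := fun r => τ r * σ r * (τ r)⁻¹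

/-- apply the blocks one after the other, head first -/
def blockPath (ρ : ι → Equiv.Perm α) : List (ι × ℤ) → α → α
  | [], y => y
  | (r, m) :: bs, y => blockPath ρ bs ((ρ r ^ m) y)

/-- number of fixed points -/
def nfix (p : Equiv.Perm α) : ℕ := (Finset.univ.filter fun i => p i = i).card

lemma explore_block (σ : ι → Equiv.Perm α) (M : ℕ) (hM : 2 * M ≤ Fintype.card α)
    (hN : 0 < Fintype.card α) (r : ι) (m : ℤ) (P : Finset (ι × α × α)) (y : α)
    (hPM : P.card + 2 ≤ M) (hy : ∀ q ∈ P, q.1 = r → q.2.2 ≠ y)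
    (E : (ι → Equiv.Perm α) → Prop) [DecidablePred E] (b : ℝ) (hb : 0 ≤ b)
    (h : ∀ z y', y' ≠ y → (∀ q ∈ P, q.2.2 ≠ y') →
      (((Tset (insert (r, (σ r ^ m) z, y') (insert (r, z, y) P))).filter E).card : ℝ) ≤
      b * (Tset (insert (r, (σ r ^ m) z, y') (insert (r, z, y) P))).card) :
    (((Tset P).filter E).card : ℝ) ≤
      ((4 * M + 2 * nfix (σ r ^ m) : ℝ) / Fintype.card α + b) * (Tset P).card := by
  have hN' : (0 : ℝ) < Fintype.card α := by exact_mod_cast hN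
  set B1 : Finset α := (Finset.univ.filter fun i => (σ r ^ m) i = i) ∪
    (P.image fun q => (σ r ^ m)⁻¹ q.2.1) with hB1
  have hB1c : B1.card ≤ nfix (σ r ^ m) + P.card := by
    refine (Finset.card_union_le _ _).trans ?_
    exact Nat.add_le_add_left Finset.card_image_le _
  set b1 : ℝ := 2 * (P.card + 1) / Fintype.card α + b with hb1
  have hmain := explore_bwd P r y hy E B1 b1 (by positivity) (by omega) hN ?_
  · refine hmain.trans ?_
    refine mul_le_mul_of_nonneg_right ?_ (Nat.cast_nonneg _)
    rw [hb1, ← add_assoc, ← add_div]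
    refine add_le_add_left ?_ _
    refine div_le_div_of_nonneg_right ?_ hN'.le
    have h1 : (B1.card : ℝ) ≤ nfix (σ r ^ m) + P.card := by exact_mod_cast hB1c
    have h2 : (P.card + 2 : ℝ) ≤ M := by exact_mod_cast hPM
    linarith
  · intro z hz
    simp only [hB1, Finset.mem_union, Finset.mem_filter, Finset.mem_univ, true_and,
      Finset.mem_image, not_or, not_exists, not_and] at hz
    set B2 : Finset α := insert y (P.image fun q => q.2.2) with hB2
    have hB2c : B2.card ≤ P.card + 1 := by
      refine (Finset.card_insert_le _ _).trans ?_
      exact Nat.add_le_add_right Finset.card_image_le _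
    have hc1 : (insert (r, z, y) P).card ≤ P.card + 1 := Finset.card_insert_le _ _
    have := explore_fwd (insert (r, z, y) P) r ((σ r ^ m) z) ?_ E B2 b hb (by omega) hN ?_
    · refine this.trans ?_
      refine mul_le_mul_of_nonneg_right ?_ (Nat.cast_nonneg _)
      rw [hb1]
      refine add_le_add_left ?_ _
      refine div_le_div_of_nonneg_right ?_ hN'.le
      have h1 : (B2.card : ℝ) ≤ P.card + 1 := by exact_mod_cast hB2c
      linarith
    · intro q hq hr hqz
      rcases Finset.mem_insert.1 hq with rfl | hq
      · exact hz.1 hqz.symm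
      · exact hz.2 q hq (by rw [Equiv.Perm.inv_eq_iff_eq]; exact hqz)
    · intro y' hy'
      simp only [hB2, Finset.mem_insert, Finset.mem_image, not_or, not_exists, not_and] at hy'
      exact h z y' hy'.1 hy'.2

theorem explore (σ : ι → Equiv.Perm α) (M : ℕ) (hM : 2 * M ≤ Fintype.card α)
    (hN : 0 < Fintype.card α) (y0 : α) (bs : List (ι × ℤ)) : ∀ (b : ι × ℤ)
    (_ : List.IsChain (fun a b => a.1 ≠ b.1) (b :: bs))
    (P : Finset (ι × α × α)) (y : α) (_ : P.card + 2 * (b :: bs).length ≤ M)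
    (_ : ∀ q ∈ P, q.1 = b.1 → q.2.2 ≠ y) (_ : y0 = y ∨ ∃ q ∈ P, q.2.2 = y0),
    (((Tset P).filter fun τ => blockPath (conjT τ σ) (b :: bs) y = y0).card : ℝ) ≤
      ((b :: bs).map fun c =>
        (4 * M + 2 * nfix (σ c.1 ^ c.2) : ℝ) / Fintype.card α).sum * (Tset P).card := by
  have hN' : (0 : ℝ) < Fintype.card α := by exact_mod_cast hN
  have hsum : ∀ l : List (ι × ℤ), 0 ≤ (l.map fun c =>
        (4 * M + 2 * nfix (σ c.1 ^ c.2) : ℝ) / Fintype.card α).sum := by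
    intro l
    refine List.sum_nonneg ?_
    intro x hx
    obtain ⟨c, _, rfl⟩ := List.mem_map.1 hx
    positivity
  have hstep : ∀ (r : ι) (m : ℤ) (l : List (ι × ℤ)) (P : Finset (ι × α × α)) (z y y' : α)
      (τ : ι → Equiv.Perm α),
      τ ∈ Tset (insert (r, (σ r ^ m) z, y') (insert (r, z, y) P)) →
      blockPath (conjT τ σ) ((r, m) :: l) y = blockPath (conjT τ σ) l y' := by
    intro r m l P z y y' τ hτ
    rw [mem_Tset] at hτ
    have h1 := hτ (r, (σ r ^ m) z, y') (Finset.mem_insert_self _ _)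
    have h2 := hτ (r, z, y) (Finset.mem_insert_of_mem (Finset.mem_insert_self _ _))
    simp only at h1 h2
    simp only [blockPath, conjT, conj_zpow, Equiv.Perm.mul_apply]
    rw [← h2, (Equiv.Perm.inv_eq_iff_eq).2 rfl, h1]
  induction bs with
  | nil =>
    rintro ⟨r, m⟩ hch P y hPM hy hy0
    simp only [List.length_cons, List.length_nil] at hPM
    have := explore_block σ M hM hN r m P y (by omega) hy
      (fun τ => blockPath (conjT τ σ) [(r, m)] y = y0) 0 le_rfl ?_
    · simpa using this
    · intro z y' hy' hP'
      rw [Finset.filter_eq_empty_iff.2]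
      · simp
      · intro τ hτ
        rw [hstep r m [] P z y y' τ hτ]
        simp only [blockPath]
        rintro rfl
        rcases hy0 with h | ⟨q, hq, h⟩
        · exact hy' h
        · exact hP' q hq h
  | cons b' bs ih =>
    rintro ⟨r, m⟩ hch P y hPM hy hy0
    rw [List.isChain_cons_cons] at hch
    simp only [List.length_cons] at hPM ih
    have := explore_block σ M hM hN r m P y (by omega) hy
      (fun τ => blockPath (conjT τ σ) ((r, m) :: b' :: bs) y = y0) _ (hsum (b' :: bs)) ?_
    · rw [List.map_cons, List.sum_cons]
      exact this
    · intro z y' hy' hP'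
      have hc1 : (insert (r, z, y) P).card ≤ P.card + 1 := Finset.card_insert_le _ _
      have hc2 : (insert (r, (σ r ^ m) z, y') (insert (r, z, y) P)).card ≤
        (insert (r, z, y) P).card + 1 := Finset.card_insert_le _ _
      have h := ih b' hch.2 (insert (r, (σ r ^ m) z, y') (insert (r, z, y) P)) y' (by omega) ?_ ?_
      · refine le_trans (le_of_eq ?_) h
        congr 2
        refine Finset.filter_congr fun τ hτ => ?_
        rw [hstep r m (b' :: bs) P z y y' τ hτ]
      · intro q hq hr
        rcases Finset.mem_insert.1 hq with rfl | hq
        · exact absurd hr hch.1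
        rcases Finset.mem_insert.1 hq with rfl | hq
        · exact fun h => hy' h.symm
        · exact hP' q hq
      · right
        rcases hy0 with h | ⟨q, hq, h⟩
        · exact ⟨(r, z, y), by simp, h.symm⟩
        · exact ⟨q, by simp [hq], h⟩
end explore


section parts
variable {α : Type*} [Fintype α] [DecidableEq α]
open Equiv.Perm

/-- number of points with minimal period `k` -/
def nper (σ : Equiv.Perm α) (k : ℕ) : ℕ :=
  (Finset.univ.filter fun i => Function.minimalPeriod (⇑σ) i = k).card

lemma minimalPeriod_dvd_iff (σ : Equiv.Perm α) (x : α) (n : ℕ) :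
    Function.minimalPeriod (⇑σ) x ∣ n ↔ (σ ^ n) x = x := by
  rw [← Function.isPeriodicPt_iff_minimalPeriod_dvd, Function.IsPeriodicPt,
    Function.IsFixedPt, Equiv.Perm.iterate_eq_pow]

lemma minimalPeriod_eq_support (σ : Equiv.Perm α) (x : α) (hx : σ x ≠ x) :
    Function.minimalPeriod (⇑σ) x = (σ.cycleOf x).support.card := by
  have hc : (σ.cycleOf x).IsCycle := isCycle_cycleOf σ hx
  rw [← hc.orderOf]
  refine Nat.dvd_right_iff_eq.1 fun n => ?_
  rw [minimalPeriod_dvd_iff, orderOf_dvd_iff_pow_eq_one,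
    hc.pow_eq_one_iff' (x := x) (by rwa [cycleOf_apply_self]), cycleOf_pow_apply_self]

lemma nper_eq (σ : Equiv.Perm α) (k : ℕ) (hk : 0 < k) :
    nper σ k = k * σ.partition.parts.count k := by
  rcases Nat.lt_or_ge k 2 with h2 | h2
  · obtain rfl : k = 1 := by omega
    rw [parts_partition, Multiset.count_add, Multiset.count_replicate_self, one_mul,
      Multiset.count_eq_zero_of_notMem (fun h => by have := two_le_of_mem_cycleType h; omega),
      zero_add, nper, ← Finset.card_compl]
    congr 1
    ext i
    simp [Function.minimalPeriod_eq_one_iff_isFixedPt, Function.IsFixedPt]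
  · rw [parts_partition, Multiset.count_add, Multiset.count_replicate, if_neg (by omega),
      add_zero, cycleType_def, Multiset.count_map]
    have : (Finset.univ.filter fun i => Function.minimalPeriod (⇑σ) i = k) =
      (σ.cycleFactorsFinset.filter fun c => k = c.support.card).biUnion fun c => c.support := by
      ext i
      simp only [Finset.mem_filter, Finset.mem_univ, true_and, Finset.mem_biUnion]
      constructor
      · intro h
        have hi : σ i ≠ i := by
          intro h'
          have : Function.minimalPeriod (⇑σ) i = 1 :=
            Function.minimalPeriod_eq_one_iff_isFixedPt.2 h'
          omega
        refine ⟨σ.cycleOf i, ⟨cycleOf_mem_cycleFactorsFinset_iff.2 (by simpa using hi), ?_⟩, ?_⟩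
        · rw [← minimalPeriod_eq_support σ i hi, h]
        · simpa [mem_support_cycleOf_iff, SameCycle.rfl] using hi
      · rintro ⟨c, ⟨hc, hk⟩, hi⟩
        have hi' := mem_cycleFactorsFinset_support_le hc hi
        have := cycle_is_cycleOf hi hc
        rw [minimalPeriod_eq_support σ i (by simpa using hi'), ← this, hk]
    rw [nper, this, Finset.card_biUnion]
    · rw [Finset.sum_congr rfl (g := fun _ => k)]
      · rw [Finset.sum_const, smul_eq_mul, mul_comm]
        rfl
      · intro c hc
        exact (Finset.mem_filter.1 hc).2.symm
    · intro c hc c' hc' hne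
      have := cycleFactorsFinset_pairwise_disjoint σ (Finset.mem_filter.1 hc).1
        (Finset.mem_filter.1 hc').1 hne
      exact this.disjoint_support

/-- weight of a cycle type -/
def W (p : Multiset ℕ) : ℝ := 1 / ((p.prod : ℝ) * ∏ n ∈ p.toFinset, ((p.count n).factorial : ℝ))

lemma card_partition_eq (p : (Fintype.card α).Partition) :
    ((Finset.univ.filter fun σ : Equiv.Perm α => σ.partition = p).card : ℝ) =
      (Fintype.card α).factorial * W p.parts := by
  set m := p.parts.filter fun n => 2 ≤ n with hm
  have hdec : p.parts = m + Multiset.replicate (p.parts.count 1) 1 := by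
    rw [← Multiset.filter_eq', hm]
    conv_lhs => rw [← Multiset.filter_add_not (fun n => 2 ≤ n) p.parts]
    congr 1
    refine Multiset.filter_congr fun n hn => ?_
    have := p.parts_pos hn
    omega
  set c := p.parts.count 1 with hc
  have hm2 : ∀ a ∈ m, 2 ≤ a := fun a ha => (Multiset.mem_filter.1 ha).2
  have hsum : m.sum + c = Fintype.card α := by
    rw [← p.parts_sum]
    conv_rhs => rw [hdec]
    simp
  have h1m : 1 ∉ m := fun h => by have := hm2 1 h; omega
  have heq : (Finset.univ.filter fun σ : Equiv.Perm α => σ.partition = p) =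
      Finset.univ.filter fun σ : Equiv.Perm α => σ.cycleType = m := by
    refine Finset.filter_congr fun σ _ => ?_
    constructor
    · rintro rfl
      rw [hm, filter_parts_partition_eq_cycleType]
    · intro h
      rw [Nat.Partition.ext_iff, parts_partition, hdec, h]
      congr 2
      rw [← sum_cycleType, h]
      omega
  rw [heq]
  have hcard := card_of_cycleType_mul_eq α m
  rw [if_pos ⟨by omega, hm2⟩] at hcard
  have hc' : Fintype.card α - m.sum = c := by omega
  rw [hc'] at hcard
  have hW : ((c.factorial * m.prod * ∏ n ∈ m.toFinset, (m.count n).factorial : ℕ) : ℝ) =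
      (p.parts.prod : ℝ) * ∏ n ∈ p.parts.toFinset, ((p.parts.count n).factorial : ℝ) := by
    have hprod : p.parts.prod = m.prod := by
      conv_lhs => rw [hdec]
      simp
    have hpr : ∏ n ∈ p.parts.toFinset, (p.parts.count n).factorial =
        c.factorial * ∏ n ∈ m.toFinset, (m.count n).factorial := by
      have e1 : ∏ n ∈ p.parts.toFinset, (p.parts.count n).factorial =
          ∏ n ∈ insert 1 m.toFinset, (p.parts.count n).factorial := by
        refine Finset.prod_subset ?_ ?_
        · intro n hn
          rw [Multiset.mem_toFinset, hdec, Multiset.mem_add] at hn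
          rcases hn with hn | hn
          · simp [hn]
          · simp [Multiset.eq_of_mem_replicate hn]
        · intro n _ hn
          rw [Multiset.mem_toFinset] at hn
          simp [hn]
      rw [e1, Finset.prod_insert (by simpa using h1m)]
      congr 1
      refine Finset.prod_congr rfl fun n hn => ?_
      have : n ≠ 1 := by
        rintro rfl
        exact h1m (Multiset.mem_toFinset.1 hn)
      conv_lhs => rw [hdec]
      rw [Multiset.count_add, Multiset.count_replicate, if_neg (by omega), add_zero]
    rw [hprod]
    have := congrArg (Nat.cast (R := ℝ)) hpr
    push_cast at this ⊢
    rw [this]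
    ring
  have hpos : (0 : ℝ) < ((c.factorial * m.prod * ∏ n ∈ m.toFinset, (m.count n).factorial : ℕ) : ℝ) := by
    have : 0 < m.prod := Multiset.prod_pos fun a ha => zero_lt_two.trans_le (hm2 a ha)
    have h2 : 0 < ∏ n ∈ m.toFinset, (m.count n).factorial :=
      Finset.prod_pos fun _ _ => Nat.factorial_pos _
    have h3 := Nat.factorial_pos c
    exact_mod_cast Nat.mul_pos (Nat.mul_pos h3 this) h2
  rw [W, ← hW, mul_one_div, eq_div_iff hpos.ne']
  exact_mod_cast hcard

lemma W_cons (q : Multiset ℕ) (k : ℕ) (hk : 0 < k) :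
    (k : ℝ) * (k ::ₘ q).count k * W (k ::ₘ q) = W q := by
  have hpr : ∏ n ∈ (k ::ₘ q).toFinset, (((k ::ₘ q).count n).factorial : ℝ) =
      (q.count k + 1 : ℝ) * ∏ n ∈ q.toFinset, ((q.count n).factorial : ℝ) := by
    have e1 : ∏ n ∈ q.toFinset, ((q.count n).factorial : ℝ) =
        ∏ n ∈ (k ::ₘ q).toFinset, ((q.count n).factorial : ℝ) := by
      refine Finset.prod_subset ?_ ?_
      · intro n hn
        simp only [Multiset.mem_toFinset, Multiset.mem_cons] at hn ⊢
        exact Or.inr hn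
      · intro n _ hn
        rw [Multiset.mem_toFinset] at hn
        simp [hn]
    have hmem : k ∈ (k ::ₘ q).toFinset := by simp
    rw [e1, ← Finset.mul_prod_erase _ _ hmem, ← Finset.mul_prod_erase _ _ hmem, ← mul_assoc]
    congr 1
    · rw [Multiset.count_cons_self, Nat.factorial_succ]
      push_cast
      ring
    · refine Finset.prod_congr rfl fun n hn => ?_
      rw [Multiset.count_cons_of_ne (Finset.ne_of_mem_erase hn)]
  have hk' : (k : ℝ) ≠ 0 := by exact_mod_cast hk.ne'
  have hc' : (q.count k + 1 : ℝ) ≠ 0 := by positivity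
  rw [W, W, hpr, Multiset.prod_cons, Multiset.count_cons_self, Nat.cast_mul, Nat.cast_add,
    Nat.cast_one]
  rw [show (k : ℝ) * q.prod * ((q.count k + 1 : ℝ) * ∏ n ∈ q.toFinset, ((q.count n).factorial : ℝ))
    = (k * (q.count k + 1)) * (q.prod * ∏ n ∈ q.toFinset, ((q.count n).factorial : ℝ)) by ring]
  rw [mul_one_div, div_mul_eq_div_div, div_self (mul_ne_zero hk' hc')]

open Classical in
/-- normalised number of permutations with cycle lengths in `A` -/
def aN (A : Set ℕ) (N : ℕ) : ℝ :=
  ∑ p ∈ (Finset.univ : Finset N.Partition).filter (fun p => ∀ j ∈ p.parts, j ∈ A), W p.parts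

open Classical in
/-- weighted moments -/
def aNg (A : Set ℕ) (g : Multiset ℕ → ℝ) (N : ℕ) : ℝ :=
  ∑ p ∈ (Finset.univ : Finset N.Partition).filter (fun p => ∀ j ∈ p.parts, j ∈ A),
    g p.parts * W p.parts

lemma aNg_one (A : Set ℕ) (N : ℕ) : aNg A (fun _ => 1) N = aN A N := by
  simp [aNg, aN]

lemma aNg_remove (A : Set ℕ) (g : Multiset ℕ → ℝ) (k N : ℕ) (hk : 0 < k) (hkA : k ∈ A)
    (hkN : k ≤ N) :
    aNg A (fun p => k * p.count k * g p) N = aNg A (fun q => g (k ::ₘ q)) (N - k) := by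
  classical
  have e : aNg A (fun p => k * p.count k * g p) N =
    ∑ p ∈ (Finset.univ : Finset N.Partition).filter
      (fun p => (∀ j ∈ p.parts, j ∈ A) ∧ k ∈ p.parts), (k * p.parts.count k * g p.parts) * W p.parts := by
    rw [aNg, ← Finset.filter_filter]
    symm
    refine Finset.sum_subset (Finset.filter_subset _ _) ?_
    intro p hp hp'
    have : k ∉ p.parts := fun h => hp' (Finset.mem_filter.2 ⟨hp, h⟩)
    simp [Multiset.count_eq_zero_of_notMem this]
  rw [e, aNg]
  refine Finset.sum_bij' (fun p hp => Nat.Partition.partitionWithPartEquiv hk hkN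
      ⟨p, (Finset.mem_filter.1 hp).2.2⟩)
    (fun q _ => ((Nat.Partition.partitionWithPartEquiv hk hkN).symm q).1) ?_ ?_ ?_ ?_ ?_
  · intro p hp
    simp only [Finset.mem_filter, Finset.mem_univ, true_and] at hp ⊢
    intro j hj
    rw [Nat.Partition.partitionWithPartEquiv_apply_parts] at hj
    exact hp.1 j (Multiset.mem_of_mem_erase hj)
  · intro q hq
    simp only [Finset.mem_filter, Finset.mem_univ, true_and,
      Nat.Partition.partitionWithPartEquiv_symm_apply_parts, Multiset.mem_cons] at hq ⊢
    refine ⟨?_, Or.inl trivial⟩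
    rintro j (rfl | hj)
    · exact hkA
    · exact hq j hj
  · intro p hp
    simp
  · intro q hq
    simp
  · intro p hp
    have hkp := (Finset.mem_filter.1 hp).2.2
    rw [Nat.Partition.partitionWithPartEquiv_apply_parts]
    have := W_cons (p.parts.erase k) k hk
    simp only [Multiset.cons_erase hkp] at this ⊢
    rw [← this]
    ring

open Classical in
/-- finset of permutations with cycle lengths in `A` -/
def permF (α : Type*) [Fintype α] [DecidableEq α] (A : Set ℕ) : Finset (Equiv.Perm α) :=
  Finset.univ.filter fun σ => ∀ i, Function.minimalPeriod (⇑σ) i ∈ A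

lemma mem_permF {A : Set ℕ} {σ : Equiv.Perm α} :
    σ ∈ permF α A ↔ ∀ i, Function.minimalPeriod (⇑σ) i ∈ A := by
  simp [permF]

lemma minimalPeriod_perm_pos (σ : Equiv.Perm α) (i : α) : 0 < Function.minimalPeriod (⇑σ) i := by
  have h : Function.minimalPeriod (⇑σ) i ∣ orderOf σ := by
    rw [minimalPeriod_dvd_iff, pow_orderOf_eq_one, Equiv.Perm.one_apply]
  exact Nat.pos_of_dvd_of_pos h (orderOf_pos σ)

lemma mem_permF_iff (A : Set ℕ) (σ : Equiv.Perm α) :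
    σ ∈ permF α A ↔ ∀ j ∈ σ.partition.parts, j ∈ A := by
  classical
  simp only [permF, Finset.mem_filter, Finset.mem_univ, true_and]
  have key : ∀ j, 0 < j → (j ∈ σ.partition.parts ↔ ∃ i, Function.minimalPeriod (⇑σ) i = j) := by
    intro j hj
    have h := nper_eq σ j hj
    rw [← Multiset.count_pos]
    constructor
    · intro hc
      have : 0 < nper σ j := by rw [h]; positivity
      obtain ⟨i, hi⟩ := Finset.card_pos.1 this
      exact ⟨i, (Finset.mem_filter.1 hi).2⟩
    · rintro ⟨i, hi⟩
      have : 0 < nper σ j := Finset.card_pos.2 ⟨i, by simpa using hi⟩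
      rw [h] at this
      exact Nat.pos_of_mul_pos_left this
  constructor
  · intro h j hj
    obtain ⟨i, rfl⟩ := (key j (σ.partition.parts_pos hj)).1 hj
    exact h i
  · intro h i
    exact h _ ((key _ (minimalPeriod_perm_pos σ i)).2 ⟨i, rfl⟩)

lemma sum_permF (A : Set ℕ) (g : Multiset ℕ → ℝ) :
    ∑ σ ∈ permF α A, g σ.partition.parts =
      (Fintype.card α).factorial * aNg A g (Fintype.card α) := by
  classical
  rw [aNg, Finset.mul_sum, ← Finset.sum_fiberwise_of_maps_to (g := fun σ => σ.partition)
    (t := (Finset.univ : Finset (Fintype.card α).Partition).filter (fun p => ∀ j ∈ p.parts, j ∈ A))]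
  · refine Finset.sum_congr rfl fun p hp => ?_
    rw [Finset.sum_congr rfl (g := fun _ => g p.parts), Finset.sum_const, nsmul_eq_mul]
    · have : ((permF α A).filter fun σ => σ.partition = p) =
          Finset.univ.filter fun σ => σ.partition = p := by
        ext σ
        simp only [Finset.mem_filter, Finset.mem_univ, true_and, and_iff_right_iff_imp]
        rintro rfl
        exact (mem_permF_iff A σ).2 (Finset.mem_filter.1 hp).2
      rw [this, card_partition_eq]
      ring
    · intro σ hσ
      rw [(Finset.mem_filter.1 hσ).2]
  · intro σ hσ
    exact Finset.mem_filter.2 ⟨Finset.mem_univ _, (mem_permF_iff A σ).1 hσ⟩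

lemma card_permF (A : Set ℕ) :
    ((permF α A).card : ℝ) = (Fintype.card α).factorial * aN A (Fintype.card α) := by
  rw [← aNg_one, ← sum_permF]
  simp

lemma sum_nper (A : Set ℕ) (k : ℕ) (hk : 0 < k) (hkA : k ∈ A) (hkN : k ≤ Fintype.card α) :
    ∑ σ ∈ permF α A, (nper σ k : ℝ) =
      (Fintype.card α).factorial * aN A (Fintype.card α - k) := by
  have := aNg_remove A (fun _ => 1) k (Fintype.card α) hk hkA hkN
  rw [aNg_one] at this
  rw [← this, ← sum_permF]
  refine Finset.sum_congr rfl fun σ _ => ?_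
  rw [nper_eq σ k hk]
  push_cast
  ring

end parts

lemma W_nonneg (p : Multiset ℕ) : 0 ≤ W p :=
  one_div_nonneg.2 (mul_nonneg (Nat.cast_nonneg _)
    (Finset.prod_nonneg fun _ _ => Nat.cast_nonneg _))

lemma aN_nonneg (A : Set ℕ) (N : ℕ) : 0 ≤ aN A N := by
  exact Finset.sum_nonneg fun p _ => W_nonneg _

lemma aN_zero (A : Set ℕ) : aN A 0 = 1 := by
  classical
  rw [aN, Finset.filter_true_of_mem]
  · simp [W]
  · intro p _ j hj
    simp at hj

lemma aN_le_one (A : Set ℕ) (N : ℕ) : aN A N ≤ 1 := by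
  have h := card_permF (α := Fin N) A
  rw [Fintype.card_fin] at h
  have h2 : ((permF (Fin N) A).card : ℝ) ≤ N.factorial := by
    have := Finset.card_le_univ (permF (Fin N) A)
    rw [Fintype.card_perm, Fintype.card_fin] at this
    exact_mod_cast this
  have h3 : (0 : ℝ) < N.factorial := by exact_mod_cast N.factorial_pos
  nlinarith

lemma aN_sq (A : Set ℕ) (k N : ℕ) (hk : 0 < k) (hkA : k ∈ A) (hkN : 2 * k ≤ N) :
    aN A (N - k) ^ 2 ≤ aN A N * (aN A (N - k - k) + k * aN A (N - k)) := by
  classical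
  have h1 := aNg_remove A (fun _ => 1) k N hk hkA (by omega)
  have h2 := aNg_remove A (fun p => k * p.count k) k N hk hkA (by omega)
  have h3 := aNg_remove A (fun _ => 1) k (N - k) hk hkA (by omega)
  rw [aNg_one] at h1 h3
  have h4 : aNg A (fun q => (k : ℝ) * (k ::ₘ q).count k) (N - k) =
      aN A (N - k - k) + k * aN A (N - k) := by
    rw [← h3, ← aNg_one, aNg, aNg, aNg, Finset.mul_sum, ← Finset.sum_add_distrib]
    refine Finset.sum_congr rfl fun p _ => ?_
    rw [Multiset.count_cons_self]
    push_cast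
    ring
  rw [← h4, ← h2, ← h1]
  unfold aN aNg
  have hW : ∀ p : Multiset ℕ, 0 ≤ W p := W_nonneg
  refine Finset.sum_sq_le_sum_mul_sum_of_sq_le_mul
    ((Finset.univ : Finset N.Partition).filter (fun p => ∀ j ∈ p.parts, j ∈ A))
    (f := fun p => W p.parts)
    (g := fun p => (k * p.parts.count k * (k * p.parts.count k)) * W p.parts)
    (r := fun p => (k * p.parts.count k * 1) * W p.parts)
    (fun p _ => hW _) ?_ ?_
  · intro p _
    exact mul_nonneg (mul_self_nonneg _) (hW _)
  · intro p _
    apply le_of_eq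
    ring

open Classical in
lemma aN_rec (A : Set ℕ) (N : ℕ) :
    N * aN A N = ∑ k ∈ (Finset.Icc 1 N).filter (· ∈ A), aN A (N - k) := by
  have h : ∑ σ ∈ permF (Fin N) A, ∑ k ∈ (Finset.Icc 1 N).filter (· ∈ A), (nper σ k : ℝ) =
      N.factorial * (N * aN A N) := by
    have hc := card_permF (α := Fin N) A
    rw [Fintype.card_fin] at hc
    rw [show (N.factorial : ℝ) * (N * aN A N) = (N.factorial * aN A N) * N by ring, ← hc]
    rw [Finset.sum_congr rfl (g := fun _ => (N : ℝ)), Finset.sum_const, nsmul_eq_mul]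
    intro σ hσ
    have : N = ∑ k ∈ (Finset.Icc 1 N).filter (· ∈ A), nper σ k := by
      conv_lhs => rw [← Fintype.card_fin N, ← Finset.card_univ]
      refine Finset.card_eq_sum_card_fiberwise (f := fun i => Function.minimalPeriod (⇑σ) i) ?_
      intro i _
      have h1 := minimalPeriod_perm_pos σ i
      have h2 : Function.minimalPeriod (⇑σ) i ≤ N := by
        have := Function.minimalPeriod_le_card (f := ⇑σ) (x := i)
        simpa using this
      simp only [Finset.coe_filter, Finset.mem_Icc, Set.mem_ofPred_eq]
      exact ⟨⟨h1, h2⟩, mem_permF.1 hσ i⟩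
    exact_mod_cast this.symm
  rw [Finset.sum_comm] at h
  have h3 : (N.factorial : ℝ) ≠ 0 := by exact_mod_cast N.factorial_ne_zero
  rw [Finset.sum_congr rfl (g := fun k => (N.factorial : ℝ) * aN A (N - k)), ← Finset.mul_sum] at h
  · exact (mul_left_cancel₀ h3 h).symm
  · intro k hk
    simp only [Finset.mem_filter, Finset.mem_Icc] at hk
    have := sum_nper (α := Fin N) A k (by omega) hk.2 (by simpa using hk.1.2)
    rw [Fintype.card_fin] at this
    exact this


section analysis

/-- tail weights -/
def betaW (A : Set ℕ) (M j : ℕ) : ℝ :=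
  Aᶜ.indicator (fun j => if j = 0 then 0 else 1 / (max j M : ℕ)) j

lemma betaW_nonneg (A : Set ℕ) (M j : ℕ) : 0 ≤ betaW A M j := by
  unfold betaW
  refine Set.indicator_nonneg (fun j _ => ?_) j
  split_ifs <;> positivity

lemma betaW_le (A : Set ℕ) (M j : ℕ) : betaW A M j ≤ Aᶜ.indicator (fun j => (1 : ℝ) / j) j := by
  unfold betaW
  refine Set.indicator_le_indicator ?_
  split_ifs with h
  · positivity
  · have : (0 : ℝ) < j := by exact_mod_cast Nat.pos_of_ne_zero h
    refine one_div_le_one_div_of_le this ?_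
    exact_mod_cast le_max_left j M

lemma betaW_summable (A : Set ℕ) (hA : Summable (Aᶜ.indicator fun j => (1 : ℝ) / j)) (M : ℕ) :
    Summable (betaW A M) :=
  Summable.of_nonneg_of_le (betaW_nonneg A M) (betaW_le A M) hA

lemma betaW_tendsto (A : Set ℕ) (hA : Summable (Aᶜ.indicator fun j => (1 : ℝ) / j)) :
    Tendsto (fun M => ∑' j, betaW A M j) atTop (𝓝 0) := by
  have := tendsto_tsum_of_dominated_convergence (𝓕 := atTop) (f := fun M j => betaW A M j)
    (g := fun _ => (0 : ℝ)) hA ?_ ?_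
  · simpa using this
  · intro j
    have h1 : Tendsto (fun M : ℕ => (1 : ℝ) / M) atTop (𝓝 0) := tendsto_one_div_atTop_nhds_zero_nat
    refine tendsto_of_tendsto_of_tendsto_of_le_of_le' tendsto_const_nhds h1
      (Eventually.of_forall fun M => betaW_nonneg A M j) ?_
    filter_upwards [eventually_gt_atTop 0] with M hM
    have hM' : (0 : ℝ) < M := by exact_mod_cast hM
    unfold betaW
    refine Set.indicator_le' (f := fun j : ℕ => if j = 0 then (0 : ℝ) else 1 / (max j M : ℕ))
      (g := fun _ => (1 : ℝ) / M) ?_ ?_ j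
    · intro j _
      split_ifs
      · positivity
      · refine one_div_le_one_div_of_le hM' ?_
        exact_mod_cast le_max_right j M
    · intro j _
      positivity
  · refine Eventually.of_forall fun M j => ?_
    rw [Real.norm_of_nonneg (betaW_nonneg A M j)]
    exact betaW_le A M j

open Classical in
theorem lower_bound (A : Set ℕ) (hA : Summable (Aᶜ.indicator fun j => (1 : ℝ) / j))
    (a : ℕ → ℝ) (a0 : a 0 = 1) (apos : ∀ n, 0 ≤ a n) (ale : ∀ n, a n ≤ 1)
    (hrec : ∀ N : ℕ, N * a N = ∑ k ∈ (Finset.Icc 1 N).filter (· ∈ A), a (N - k)) :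
    ∃ c > 0, ∃ N0 : ℕ, ∀ N ≥ N0, c ≤ a N := by
  set s : ℕ → ℝ := fun N => ∑ m ∈ Finset.range N, a m with hs
  set B : ℕ → Finset ℕ := fun N => (Finset.Icc 1 N).filter (· ∉ A) with hB
  set e : ℕ → ℝ := fun N => ∑ j ∈ B N, a (N - j) with he
  have e0 : ∀ N, 0 ≤ e N := fun N => Finset.sum_nonneg fun _ _ => apos _
  have hrec' : ∀ N : ℕ, N * a N = s N - e N := by
    intro N
    rw [hrec, eq_sub_iff_add_eq, he, Finset.sum_filter_add_sum_filter_not, hs]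
    simp only
    rw [← Finset.sum_range_reflect, Finset.range_eq_Ico]
    refine Finset.sum_bij' (fun k _ => k - 1) (fun k _ => k + 1) ?_ ?_ ?_ ?_ ?_
    · intro k hk; simp only [Finset.mem_Icc, Finset.mem_Ico] at *; omega
    · intro k hk; simp only [Finset.mem_Icc, Finset.mem_Ico] at *; omega
    · intro k hk; simp only [Finset.mem_Icc, Finset.mem_Ico] at *; omega
    · intro k hk; simp only [Finset.mem_Icc, Finset.mem_Ico] at *; omega
    · intro k hk
      simp only [Finset.mem_Icc] at hk
      congr 1
      omega
  set t : ℕ → ℝ := fun N => s N / N with ht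
  have tstep : ∀ N : ℕ, 0 < N → t N - t (N + 1) = e N / (N * (N + 1)) := by
    intro N hN
    have hN' : (0 : ℝ) < N := by exact_mod_cast hN
    have h1 : s (N + 1) = s N + a N := Finset.sum_range_succ _ _
    have h2 := hrec' N
    simp only [ht, h1]
    push_cast
    have h3 : e N = s N - N * a N := by linarith
    rw [h3]
    field_simp
    ring
  have s0 : ∀ N, 0 ≤ s N := fun N => Finset.sum_nonneg fun _ _ => apos _
  have t0 : ∀ N, 0 ≤ t N := fun N => div_nonneg (s0 N) (Nat.cast_nonneg _)
  have at_le : ∀ N : ℕ, 0 < N → a N ≤ t N := by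
    intro N hN
    have hN' : (0 : ℝ) < N := by exact_mod_cast hN
    rw [ht]
    simp only
    rw [le_div_iff₀ hN']
    have := hrec' N
    have := e0 N
    linarith
  have tanti : ∀ M N : ℕ, 0 < M → M ≤ N → t N ≤ t M := by
    intro M N hM hMN
    induction N, hMN using Nat.le_induction with
    | base => exact le_rfl
    | succ N hN ih =>
      have h1 := tstep N (by omega)
      have h2 : 0 ≤ e N / (N * (N + 1)) := div_nonneg (e0 N) (by positivity)
      linarith
  have tsum : ∀ M K : ℕ, 0 < M → M ≤ K → t M - t K = ∑ N ∈ Finset.Ico M K, e N / (N * (N + 1)) := by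
    intro M K hM hMK
    induction K, hMK using Nat.le_induction with
    | base => simp
    | succ K hK ih =>
      rw [Finset.sum_Ico_succ_top hK, ← ih, ← tstep K (by omega)]
      ring
  have tele : ∀ X K : ℕ, 0 < X → ∑ N ∈ Finset.Ico X K, (1 : ℝ) / (N * (N + 1)) ≤ 1 / X := by
    intro X K hX
    rcases Nat.lt_or_ge K X with h | h
    · rw [Finset.Ico_eq_empty_of_le h.le]
      simp
    · have : ∑ N ∈ Finset.Ico X K, (1 : ℝ) / (N * (N + 1)) = 1 / X - 1 / K := by
        induction K, h using Nat.le_induction with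
        | base => simp
        | succ K hK ih =>
          have hK' : (0 : ℝ) < K := by exact_mod_cast (by omega : 0 < K)
          rw [Finset.sum_Ico_succ_top hK, ih]
          push_cast
          field_simp
          ring
      rw [this]
      have : (0 : ℝ) ≤ 1 / K := by positivity
      linarith
  have perj : ∀ M K j : ℕ, 0 < M → 0 < j →
      ∑ N ∈ (Finset.Ico M K).filter (j ≤ ·), a (N - j) / (N * (N + 1)) ≤
        2 * t M * (1 / (max j M : ℕ)) := by
    intro M K j hM hj
    set X := max j M with hX
    have hXpos : 0 < X := by omega
    have hX' : (0 : ℝ) < X := by exact_mod_cast hXpos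
    have hIco : (Finset.Ico M K).filter (j ≤ ·) = Finset.Ico X K := by
      ext N
      simp only [Finset.mem_filter, Finset.mem_Ico]
      omega
    rw [hIco]
    have hM' : (0 : ℝ) < M := by exact_mod_cast hM
    have p1 : ∀ N ∈ Finset.Ico X K, a (N - j) / (N * (N + 1)) ≤
        t M * (1 / (N * (N + 1))) + (if N - j < M then a (N - j) else 0) * (1 / (X * X)) := by
      intro N hN
      rw [Finset.mem_Ico] at hN
      have hXN : (X : ℝ) ≤ N := by exact_mod_cast hN.1
      split_ifs with h
      · have q1 : a (N - j) / (N * (N + 1)) ≤ a (N - j) * (1 / (X * X)) := by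
          rw [div_eq_mul_one_div]
          refine mul_le_mul_of_nonneg_left ?_ (apos _)
          refine one_div_le_one_div_of_le (by positivity) ?_
          nlinarith
        have q2 : 0 ≤ t M * (1 / (N * (N + 1))) := mul_nonneg (t0 M) (by positivity)
        linarith
      · rw [zero_mul, add_zero, div_eq_mul_one_div]
        refine mul_le_mul_of_nonneg_right ?_ (by positivity)
        exact (at_le _ (by omega)).trans (tanti M (N - j) hM (by omega))
    refine (Finset.sum_le_sum p1).trans ?_
    rw [Finset.sum_add_distrib, ← Finset.mul_sum, ← Finset.sum_mul]
    have p2 : ∑ N ∈ Finset.Ico X K, (if N - j < M then a (N - j) else 0) ≤ s M := by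
      rw [← Finset.sum_filter, hs]
      have : ∑ N ∈ (Finset.Ico X K).filter (fun N => N - j < M), a (N - j) =
          ∑ m ∈ ((Finset.Ico X K).filter (fun N => N - j < M)).image (fun N => N - j), a m := by
        rw [Finset.sum_image]
        intro x hx y hy hxy
        simp only [Finset.coe_filter, Finset.mem_Ico, Set.mem_ofPred_eq] at hx hy
        simp only at hxy
        omega
      rw [this]
      refine Finset.sum_le_sum_of_subset_of_nonneg ?_ (fun _ _ _ => apos _)
      intro m hm
      obtain ⟨N, hN, rfl⟩ := Finset.mem_image.1 hm
      exact Finset.mem_range.2 (Finset.mem_filter.1 hN).2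
    have p3 : s M = M * t M := by
      rw [ht]
      field_simp
    have p4 := tele X K hXpos
    have p5 : t M * ∑ N ∈ Finset.Ico X K, (1 : ℝ) / (N * (N + 1)) ≤ t M * (1 / X) :=
      mul_le_mul_of_nonneg_left p4 (t0 M)
    have p6 : (∑ N ∈ Finset.Ico X K, (if N - j < M then a (N - j) else 0)) * (1 / (X * X) : ℝ)
        ≤ t M * (1 / X) := by
      refine (mul_le_mul_of_nonneg_right p2 (by positivity)).trans ?_
      rw [p3, mul_comm (M : ℝ), mul_assoc]
      refine mul_le_mul_of_nonneg_left ?_ (t0 M)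
      rw [mul_one_div, div_le_div_iff₀ (by positivity) hX']
      have : (M : ℝ) ≤ X := by exact_mod_cast le_max_right j M
      nlinarith
    linarith
  have betaSum : ∀ M K : ℕ, ∑ j ∈ B K, (1 / (max j M : ℕ) : ℝ) ≤ ∑' j, betaW A M j := by
    intro M K
    have : ∑ j ∈ B K, (1 / (max j M : ℕ) : ℝ) = ∑ j ∈ B K, betaW A M j := by
      refine Finset.sum_congr rfl fun j hj => ?_
      simp only [hB, Finset.mem_filter, Finset.mem_Icc] at hj
      rw [betaW, Set.indicator_of_mem (by exact hj.2), if_neg (by omega)]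
    rw [this]
    exact (betaW_summable A hA M).sum_le_tsum _ (fun j _ => betaW_nonneg A M j)
  have tdiff : ∀ M K : ℕ, 0 < M → M ≤ K → t M - t K ≤ 2 * t M * ∑' j, betaW A M j := by
    intro M K hM hMK
    rw [tsum M K hM hMK]
    have q1 : ∑ N ∈ Finset.Ico M K, e N / (N * (N + 1)) =
        ∑ j ∈ B K, ∑ N ∈ (Finset.Ico M K).filter (j ≤ ·), a (N - j) / (N * (N + 1)) := by
      simp only [he, Finset.sum_div]
      refine Finset.sum_comm' ?_
      intro N j
      simp only [hB, Finset.mem_Ico, Finset.mem_filter, Finset.mem_Icc]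
      constructor
      · rintro ⟨⟨h1, h2⟩, ⟨h3, h4⟩, h5⟩
        exact ⟨⟨⟨h1, h2⟩, h4⟩, ⟨h3, by omega⟩, h5⟩
      · rintro ⟨⟨⟨h1, h2⟩, h4⟩, ⟨h3, _⟩, h5⟩
        exact ⟨⟨h1, h2⟩, ⟨h3, h4⟩, h5⟩
    rw [q1]
    refine (Finset.sum_le_sum (fun j hj => perj M K j hM ?_)).trans ?_
    · simp only [hB, Finset.mem_filter, Finset.mem_Icc] at hj
      omega
    · rw [← Finset.mul_sum]
      exact mul_le_mul_of_nonneg_left (betaSum M K) (by have := t0 M; positivity)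
  have hlim := betaW_tendsto A hA
  obtain ⟨M, hM4, hM⟩ := ((hlim.eventually (gt_mem_nhds (show (0 : ℝ) < 1 / 4 by norm_num))).and
    (eventually_gt_atTop 0)).exists
  have sM : 1 ≤ s M := by
    rw [← a0, hs]
    exact Finset.single_le_sum (fun i _ => apos i) (Finset.mem_range.2 hM)
  have tM : 0 < t M := by
    have : (0 : ℝ) < M := by exact_mod_cast hM
    exact div_pos (by linarith) this
  have tK : ∀ K, M ≤ K → t M / 2 ≤ t K := by
    intro K hK
    have := tdiff M K hM hK
    nlinarith
  obtain ⟨N0, hN0⟩ := eventually_atTop.1 (hlim.eventually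
    (gt_mem_nhds (show (0 : ℝ) < t M / 4 by linarith)))
  refine ⟨t M / 4, by linarith, max N0 M, fun N hN => ?_⟩
  have hNM : M ≤ N := (le_max_right _ _).trans hN
  have hNpos : 0 < N := by omega
  have hN' : (0 : ℝ) < N := by exact_mod_cast hNpos
  have h1 := hN0 N ((le_max_left _ _).trans hN)
  have h2 := tK N hNM
  have h3 := betaSum N N
  have h4 : e N / N ≤ ∑ j ∈ B N, (1 / (max j N : ℕ) : ℝ) := by
    rw [he]
    simp only
    rw [Finset.sum_div]
    refine Finset.sum_le_sum fun j hj => ?_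
    simp only [hB, Finset.mem_filter, Finset.mem_Icc] at hj
    rw [max_eq_right hj.1.2]
    exact div_le_div_of_nonneg_right (ale _) hN'.le
  have h5 : a N = t N - e N / N := by
    have := hrec' N
    rw [ht]
    field_simp
    linarith
  linarith

theorem aN_lower (A : Set ℕ) (hA : Summable (Aᶜ.indicator fun j => (1 : ℝ) / j)) :
    ∃ c > 0, ∃ N0 : ℕ, ∀ N ≥ N0, c ≤ aN A N := by
  classical
  refine lower_bound A hA (aN A) (aN_zero A) (aN_nonneg A) (aN_le_one A) ?_
  intro N
  rw [aN_rec]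

lemma aN_step (A : Set ℕ) (d N : ℕ) (hd : 0 < d) (hdA : d ∈ A) (hdN : d ≤ N) :
    aN A (N - d) ≤ N * aN A N := by
  classical
  rw [aN_rec]
  refine Finset.single_le_sum (f := fun k => aN A (N - k)) (fun k _ => aN_nonneg A _) ?_
  simp only [Finset.mem_filter, Finset.mem_Icc]
  exact ⟨⟨hd, hdN⟩, hdA⟩

theorem aN_ratio (A : Set ℕ) (d k : ℕ) (hk : 0 < k) (hkd : k < d) (hdA : d ∈ A) (hkA : k ∈ A)
    (ε : ℝ) (hε : 0 < ε) :
    ∃ N0 : ℕ, ∀ N ≥ N0, 0 < aN A N → aN A (N - k) ≤ ε * N * aN A N := by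
  obtain ⟨N1, hN1⟩ := exists_nat_gt (2 * (d * k : ℝ) / ε)
  obtain ⟨N2, hN2⟩ := exists_nat_gt (((ε / 2) ^ d)⁻¹)
  refine ⟨max (max N1 N2) (2 * d * k + 2 * k + 1), fun N hN hpos => ?_⟩
  have hNa : N1 ≤ N := (le_max_left _ _).trans ((le_max_left _ _).trans hN)
  have hNb : N2 ≤ N := (le_max_right _ _).trans ((le_max_left _ _).trans hN)
  have hNc : 2 * d * k + 2 * k + 1 ≤ N := (le_max_right _ _).trans hN
  have hNpos : (0 : ℝ) < N := by exact_mod_cast (by omega : 0 < N)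
  have hN1' : (2 * (d * k : ℝ)) < ε * N := by
    have : (N1 : ℝ) ≤ N := by exact_mod_cast hNa
    rw [div_lt_iff₀ hε] at hN1
    nlinarith
  have hN2' : 1 < (ε / 2) ^ d * N := by
    have h1 : (N2 : ℝ) ≤ N := by exact_mod_cast hNb
    have h2 : 0 < (ε / 2) ^ d := by positivity
    have h3 : ((ε / 2) ^ d)⁻¹ < N := lt_of_lt_of_le hN2 h1
    rwa [inv_lt_iff_one_lt_mul₀ h2, mul_comm] at h3
  by_contra! hcon
  have key : ∀ j : ℕ, j < d → 0 < aN A (N - j * k) ∧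
      (ε * N - j * k) * aN A (N - j * k) ≤ aN A (N - (j + 1) * k) := by
    intro j
    induction j with
    | zero =>
      intro _
      simp only [zero_mul, Nat.sub_zero, zero_add, one_mul, Nat.cast_zero, sub_zero]
      exact ⟨hpos, hcon.le⟩
    | succ j ih =>
      intro hj
      obtain ⟨h1, h2⟩ := ih (by omega)
      have hjk : (j + 1) * k ≤ d * k := Nat.mul_le_mul_right k (by omega)
      have hjk' : ((j + 1 : ℕ) : ℝ) * k ≤ d * k := by exact_mod_cast hjk
      push_cast at hjk'
      have hkpos : (0 : ℝ) < k := by exact_mod_cast hk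
      have hc : 0 < ε * N - j * k := by nlinarith
      have hy : 0 < aN A (N - (j + 1) * k) := lt_of_lt_of_le (mul_pos hc h1) h2
      refine ⟨hy, ?_⟩
      have hlin : (j + 1) * k = j * k + k := by ring
      have hlin2 : (j + 1 + 1) * k = j * k + k + k := by ring
      have hdk : 2 * d * k = d * k + d * k := by ring
      have hsq := aN_sq A k (N - j * k) hk hkA (by omega)
      have e1 : N - j * k - k = N - (j + 1) * k := by omega
      have e2 : N - j * k - k - k = N - (j + 1 + 1) * k := by omega
      rw [e2, e1] at hsq
      set x := aN A (N - j * k)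
      set y := aN A (N - (j + 1) * k)
      set z := aN A (N - (j + 1 + 1) * k)
      push_cast
      have h3 : y * ((ε * N - j * k) * x) ≤ x * (z + k * y) := by nlinarith
      have h4 : x * (y * (ε * N - j * k)) ≤ x * (z + k * y) := by linarith
      have h5 := le_of_mul_le_mul_left h4 h1
      linarith
  have grow : ∀ j : ℕ, j ≤ d → (ε * N / 2) ^ j * aN A N ≤ aN A (N - j * k) := by
    intro j
    induction j with
    | zero => intro _; simp
    | succ j ih =>
      intro hj
      have h1 := ih (by omega)
      obtain ⟨h2, h3⟩ := key j (by omega)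
      have hjk : j * k ≤ d * k := Nat.mul_le_mul_right k (by omega)
      have hjk' : (j : ℝ) * k ≤ d * k := by exact_mod_cast hjk
      have h4 : ε * N / 2 ≤ ε * N - j * k := by linarith
      calc (ε * N / 2) ^ (j + 1) * aN A N = (ε * N / 2) * ((ε * N / 2) ^ j * aN A N) := by ring
        _ ≤ (ε * N / 2) * aN A (N - j * k) := mul_le_mul_of_nonneg_left h1 (by positivity)
        _ ≤ (ε * N - j * k) * aN A (N - j * k) := mul_le_mul_of_nonneg_right h4 h2.le
        _ ≤ _ := h3
  have shrink : ∀ j : ℕ, j ≤ k → aN A (N - j * d) ≤ (N : ℝ) ^ j * aN A N := by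
    intro j
    induction j with
    | zero => intro _; simp
    | succ j ih =>
      intro hj
      have h1 := ih (by omega)
      have hjk : (j + 1) * d ≤ k * d := Nat.mul_le_mul_right d hj
      have hlin : (j + 1) * d = j * d + d := by ring
      have hdk : 2 * d * k = k * d + k * d := by ring
      have h2 := aN_step A d (N - j * d) (by omega) hdA (by omega)
      have e1 : N - j * d - d = N - (j + 1) * d := by omega
      rw [e1] at h2
      have h3 : ((N - j * d : ℕ) : ℝ) ≤ N := by exact_mod_cast Nat.sub_le _ _
      calc aN A (N - (j + 1) * d) ≤ ((N - j * d : ℕ) : ℝ) * aN A (N - j * d) := h2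
        _ ≤ N * aN A (N - j * d) := mul_le_mul_of_nonneg_right h3 (aN_nonneg A _)
        _ ≤ N * ((N : ℝ) ^ j * aN A N) := mul_le_mul_of_nonneg_left h1 hNpos.le
        _ = _ := by ring
  have g := grow d le_rfl
  have h := shrink k le_rfl
  rw [mul_comm k d] at h
  have hh : (ε * N / 2) ^ d ≤ (N : ℝ) ^ k := le_of_mul_le_mul_right (g.trans h) hpos
  have hfin : (N : ℝ) ^ k < (ε * N / 2) ^ d := by
    have hN1 : (1 : ℝ) ≤ N := by exact_mod_cast (by omega : 1 ≤ N)
    calc (N : ℝ) ^ k = 1 * (N : ℝ) ^ k := (one_mul _).symm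
      _ < ((ε / 2) ^ d * N) * (N : ℝ) ^ k := mul_lt_mul_of_pos_right hN2' (by positivity)
      _ = (ε / 2) ^ d * (N : ℝ) ^ (k + 1) := by ring
      _ ≤ (ε / 2) ^ d * (N : ℝ) ^ d :=
        mul_le_mul_of_nonneg_left (pow_le_pow_right₀ hN1 hkd) (by positivity)
      _ = (ε * N / 2) ^ d := by rw [← mul_pow]; congr 1; ring
  linarith

end analysis

section averages
variable {s : ℕ}

/-- the sample space -/
def Om (A : Fin s → Set ℕ) (N : ℕ) : Finset (Fin s → Equiv.Perm (Fin N)) :=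
  Fintype.piFinset fun r => permF (Fin N) (A r)

/-- real averages over the sample space -/
def av (A : Fin s → Set ℕ) (N : ℕ) (f : (Fin s → Equiv.Perm (Fin N)) → ℝ) : ℝ :=
  (∑ σ ∈ Om A N, f σ) / (Om A N).card

lemma mem_Om {A : Fin s → Set ℕ} {N : ℕ} {σ : Fin s → Equiv.Perm (Fin N)} :
    σ ∈ Om A N ↔ ∀ r, σ r ∈ permF (Fin N) (A r) := by
  simp [Om]

lemma av_mono {A : Fin s → Set ℕ} {N : ℕ} {f g : (Fin s → Equiv.Perm (Fin N)) → ℝ}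
    (h : ∀ σ ∈ Om A N, f σ ≤ g σ) : av A N f ≤ av A N g :=
  div_le_div_of_nonneg_right (Finset.sum_le_sum h) (Nat.cast_nonneg _)

lemma av_zero (A : Fin s → Set ℕ) (N : ℕ) : av A N (fun _ => 0) = 0 := by
  simp [av]

lemma av_nonneg {A : Fin s → Set ℕ} {N : ℕ} {f : (Fin s → Equiv.Perm (Fin N)) → ℝ}
    (h : ∀ σ ∈ Om A N, 0 ≤ f σ) : 0 ≤ av A N f :=
  div_nonneg (Finset.sum_nonneg h) (Nat.cast_nonneg _)

lemma av_add (A : Fin s → Set ℕ) (N : ℕ) (f g : (Fin s → Equiv.Perm (Fin N)) → ℝ) :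
    av A N (fun σ => f σ + g σ) = av A N f + av A N g := by
  simp [av, Finset.sum_add_distrib, add_div]

lemma av_cmul (A : Fin s → Set ℕ) (N : ℕ) (c : ℝ) (f : (Fin s → Equiv.Perm (Fin N)) → ℝ) :
    av A N (fun σ => c * f σ) = c * av A N f := by
  simp [av, ← Finset.mul_sum, mul_div_assoc]

lemma av_sum (A : Fin s → Set ℕ) (N : ℕ) {κ : Type*} (T : Finset κ)
    (f : κ → (Fin s → Equiv.Perm (Fin N)) → ℝ) :
    av A N (fun σ => ∑ k ∈ T, f k σ) = ∑ k ∈ T, av A N (f k) := by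
  simp only [av]
  rw [Finset.sum_comm, Finset.sum_div]

lemma av_const (A : Fin s → Set ℕ) (N : ℕ) (hne : (Om A N).Nonempty) (c : ℝ) :
    av A N (fun _ => c) = c := by
  have : ((Om A N).card : ℝ) ≠ 0 := by exact_mod_cast hne.card_pos.ne'
  simp only [av, Finset.sum_const, nsmul_eq_mul]
  field_simp

lemma av_const_le (A : Fin s → Set ℕ) (N : ℕ) (c : ℝ) (hc : 0 ≤ c) :
    av A N (fun _ => c) ≤ c := by
  rcases (Om A N).eq_empty_or_nonempty with h | h
  · simp [av, h, hc]
  · rw [av_const A N h]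

lemma Om_nonempty {A : Fin s → Set ℕ} {N : ℕ} (hne : ∀ r, (permF (Fin N) (A r)).Nonempty) :
    (Om A N).Nonempty := by
  choose f hf using hne
  exact ⟨f, mem_Om.2 hf⟩

lemma av_marg (A : Fin s → Set ℕ) (N : ℕ) (hne : ∀ r, (permF (Fin N) (A r)).Nonempty)
    (r : Fin s) (f : Equiv.Perm (Fin N) → ℝ) :
    av A N (fun σ => f (σ r)) =
      (∑ τ ∈ permF (Fin N) (A r), f τ) / (permF (Fin N) (A r)).card := by
  have h := Finset.prod_univ_sum (fun r' => permF (Fin N) (A r'))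
    (fun (r' : Fin s) (τ : Equiv.Perm (Fin N)) => if r' = r then f τ else (1 : ℝ))
  have h1 : ∀ σ : Fin s → Equiv.Perm (Fin N),
      (∏ i, if i = r then f (σ i) else (1 : ℝ)) = f (σ r) := by
    intro σ
    rw [Finset.prod_eq_single r]
    · simp
    · intro b _ hb
      simp [hb]
    · simp
  simp only [h1] at h
  have hc : ((Om A N).card : ℝ) = ∏ r', ((permF (Fin N) (A r')).card : ℝ) := by
    rw [Om, Fintype.card_piFinset]
    push_cast
    rfl
  have hpos : ∀ r', ((permF (Fin N) (A r')).card : ℝ) ≠ 0 := fun r' => by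
    exact_mod_cast (hne r').card_pos.ne'
  rw [av, hc]
  unfold Om
  rw [← h, ← Finset.prod_div_distrib, Finset.prod_eq_single r]
  · simp
  · intro b _ hb
    simp [hb, hpos b]
  · simp

lemma minimalPeriod_conj {α : Type*} (τ σ : Equiv.Perm α) (i : α) :
    Function.minimalPeriod (⇑(τ * σ * τ⁻¹)) i = Function.minimalPeriod (⇑σ) (τ⁻¹ i) := by
  have h : ∀ n, Function.minimalPeriod (⇑(τ * σ * τ⁻¹)) i ∣ n ↔
      Function.minimalPeriod (⇑σ) (τ⁻¹ i) ∣ n := by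
    intro n
    rw [← Function.isPeriodicPt_iff_minimalPeriod_dvd,
      ← Function.isPeriodicPt_iff_minimalPeriod_dvd, Function.IsPeriodicPt,
      Function.IsFixedPt, Equiv.Perm.iterate_eq_pow, Function.IsPeriodicPt,
      Function.IsFixedPt, Equiv.Perm.iterate_eq_pow, conj_pow]
    simp only [Equiv.Perm.mul_apply]
    rw [Equiv.Perm.eq_inv_iff_eq]
  exact Nat.dvd_antisymm ((h _).2 dvd_rfl) ((h _).1 dvd_rfl)

lemma conjT_mem {A : Fin s → Set ℕ} {N : ℕ} (τ : Fin s → Equiv.Perm (Fin N))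
    {σ : Fin s → Equiv.Perm (Fin N)} (h : σ ∈ Om A N) : conjT τ σ ∈ Om A N := by
  rw [mem_Om] at h ⊢
  intro r
  rw [mem_permF]
  intro i
  rw [conjT, minimalPeriod_conj]
  exact mem_permF.1 (h r) _

lemma conjT_inv {N : ℕ} (τ σ : Fin s → Equiv.Perm (Fin N)) : conjT τ⁻¹ (conjT τ σ) = σ := by
  funext r
  simp [conjT, mul_assoc]

lemma sum_conj (A : Fin s → Set ℕ) (N : ℕ) (τ : Fin s → Equiv.Perm (Fin N))
    (f : (Fin s → Equiv.Perm (Fin N)) → ℝ) :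
    ∑ σ ∈ Om A N, f (conjT τ σ) = ∑ σ ∈ Om A N, f σ := by
  refine Finset.sum_bij' (fun σ _ => conjT τ σ) (fun σ _ => conjT τ⁻¹ σ) ?_ ?_ ?_ ?_ ?_
  · intro σ h; exact conjT_mem τ h
  · intro σ h; exact conjT_mem _ h
  · intro σ _; exact conjT_inv τ σ
  · intro σ _
    have := conjT_inv τ⁻¹ σ
    rwa [inv_inv] at this
  · intro σ _; rfl

lemma av_nper (A : Fin s → Set ℕ) (N : ℕ) (hne : ∀ r, (permF (Fin N) (A r)).Nonempty)
    (r : Fin s) (k : ℕ) (hk : 0 < k) (hkA : k ∈ A r) (hkN : k ≤ N) :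
    0 < aN (A r) N ∧
    av A N (fun σ => (nper (σ r) k : ℝ) / N) = aN (A r) (N - k) / (N * aN (A r) N) := by
  have hc := card_permF (α := Fin N) (A r)
  have hs := sum_nper (α := Fin N) (A r) k hk hkA (by simpa using hkN)
  rw [Fintype.card_fin] at hc hs
  have hpos : (0 : ℝ) < (permF (Fin N) (A r)).card := by exact_mod_cast (hne r).card_pos
  have hf : (0 : ℝ) < N.factorial := by exact_mod_cast N.factorial_pos
  have ha : 0 < aN (A r) N := by
    rw [hc] at hpos
    exact pos_of_mul_pos_right hpos hf.le
  refine ⟨ha, ?_⟩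
  rw [av_marg A N hne r (fun τ => (nper τ k : ℝ) / N), ← Finset.sum_div, hs, hc]
  have hN : (0 : ℝ) < N := by exact_mod_cast lt_of_lt_of_le hk hkN
  field_simp

end averages

section small

/-- classes of small sequences -/
structure SmallClass (S : (ℕ → ℝ) → Prop) : Prop where
  zero : S fun _ => 0
  add : ∀ f g, S f → S g → S fun k => f k + g k
  cmul : ∀ (c : ℝ) f, S f → S fun k => c * f k
  dom : ∀ f g, (∀ᶠ k in atTop, 0 ≤ f k ∧ f k ≤ g k) → S g → S f

lemma SmallClass.sum {S : (ℕ → ℝ) → Prop} (h : SmallClass S) {κ : Type*} (T : Finset κ)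
    (f : κ → ℕ → ℝ) (hf : ∀ i ∈ T, S (f i)) : S fun k => ∑ i ∈ T, f i k := by
  classical
  induction T using Finset.induction_on with
  | empty => simpa using h.zero
  | insert a T ha ih =>
    simp only [Finset.sum_insert ha]
    exact h.add _ _ (hf a (Finset.mem_insert_self _ _))
      (ih fun i hi => hf i (Finset.mem_insert_of_mem hi))

lemma smallClass_tendsto : SmallClass fun f => Tendsto f atTop (𝓝 0) where
  zero := tendsto_const_nhds
  add := fun f g hf hg => by simpa using hf.add hg
  cmul := fun c f hf => by simpa using hf.const_mul c
  dom := fun f g h hg => tendsto_of_tendsto_of_tendsto_of_le_of_le' tendsto_const_nhds hg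
    (h.mono fun _ h => h.1) (h.mono fun _ h => h.2)

lemma smallClass_bigO (G : ℕ → ℝ) : SmallClass fun f => f =O[atTop] G where
  zero := Asymptotics.isBigO_zero _ _
  add := fun f g hf hg => hf.add hg
  cmul := fun c f hf => hf.const_mul_left c
  dom := fun f g h hg => by
    refine Asymptotics.IsBigO.trans (Asymptotics.IsBigO.of_bound 1 ?_) hg
    filter_upwards [h] with k hk
    rw [one_mul, Real.norm_of_nonneg hk.1, Real.norm_of_nonneg (hk.1.trans hk.2)]
    exact hk.2

end small

section single
variable {s : ℕ}

lemma infinite_nper (A : Fin s → Set ℕ) (Nk : ℕ → ℕ) (hmono : StrictMono Nk)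
    (hne : ∀ j r, (permF (Fin (Nk j)) (A r)).Nonempty) (r : Fin s) (k : ℕ) (hk : 0 < k)
    (hkA : k ∈ A r) (hA : Summable (((A r)ᶜ : Set ℕ).indicator fun j => (1 : ℝ) / j)) :
    (fun j => av A (Nk j) (fun σ => (nper (σ r) k : ℝ) / Nk j)) =O[atTop]
      fun j => (1 : ℝ) / Nk j := by
  obtain ⟨c, hc, N0, hN0⟩ := aN_lower (A r) hA
  refine Asymptotics.IsBigO.of_bound (1 / c) ?_
  filter_upwards [eventually_ge_atTop (max N0 k)] with j hj
  have hjN : j ≤ Nk j := hmono.id_le j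
  obtain ⟨h1, h2⟩ := av_nper A (Nk j) (hne j) r k hk hkA (by omega)
  have hN : (0 : ℝ) < Nk j := by
    have : 0 < Nk j := by omega
    exact_mod_cast this
  have hl := hN0 (Nk j) (by omega)
  rw [h2, Real.norm_of_nonneg (div_nonneg (aN_nonneg _ _) (by positivity)),
    Real.norm_of_nonneg (by positivity)]
  rw [div_mul_div_comm, one_mul]
  refine div_le_div₀ zero_le_one (aN_le_one _ _) (by positivity) ?_
  rw [mul_comm]
  exact mul_le_mul_of_nonneg_left hl hN.le

lemma finite_nper (A : Fin s → Set ℕ) (Nk : ℕ → ℕ) (hmono : StrictMono Nk)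
    (hne : ∀ j r, (permF (Fin (Nk j)) (A r)).Nonempty) (r : Fin s) (k D : ℕ) (hk : 0 < k)
    (hkA : k ∈ A r) (hD : D ∈ A r) (hkD : k < D) :
    Tendsto (fun j => av A (Nk j) (fun σ => (nper (σ r) k : ℝ) / Nk j)) atTop (𝓝 0) := by
  rw [Metric.tendsto_atTop]
  intro ε hε
  obtain ⟨N0, hN0⟩ := aN_ratio (A r) D k hk hkD hD hkA (ε / 2) (by positivity)
  refine ⟨max N0 k, fun j hj => ?_⟩
  have hjN : j ≤ Nk j := hmono.id_le j
  obtain ⟨h1, h2⟩ := av_nper A (Nk j) (hne j) r k hk hkA (by omega)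
  have hN : (0 : ℝ) < Nk j := by
    have : 0 < Nk j := by omega
    exact_mod_cast this
  have hl := hN0 (Nk j) (by omega) h1
  rw [Real.dist_eq, sub_zero, h2, abs_of_nonneg (div_nonneg (aN_nonneg _ _) (by positivity))]
  rw [div_lt_iff₀ (by positivity)]
  have : 0 < ε * (Nk j * aN (A r) (Nk j)) := by positivity
  nlinarith

lemma inv_Nk_tendsto (Nk : ℕ → ℕ) (hmono : StrictMono Nk) :
    Tendsto (fun j => (1 : ℝ) / Nk j) atTop (𝓝 0) := by
  have : Tendsto (fun n : ℕ => (1 : ℝ) / n) atTop (𝓝 0) := tendsto_one_div_atTop_nhds_zero_nat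
  exact this.comp hmono.tendsto_atTop

end single

section words
variable {s : ℕ}

/-- permutation of a word -/
def wperm {α : Type*} (σ : Fin s → Equiv.Perm α) (w : List (Fin s × Bool)) : Equiv.Perm α :=
  (w.map fun p => if p.2 then σ p.1 else (σ p.1)⁻¹).prod

lemma wperm_append {α : Type*} (σ : Fin s → Equiv.Perm α) (w v : List (Fin s × Bool)) :
    wperm σ (w ++ v) = wperm σ w * wperm σ v := by
  simp [wperm]

lemma wperm_nil {α : Type*} (σ : Fin s → Equiv.Perm α) : wperm σ [] = 1 := by
  simp [wperm]

/-- fraction of points at which two words differ -/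
def dis {N : ℕ} (σ : Fin s → Equiv.Perm (Fin N)) (w v : List (Fin s × Bool)) : ℝ :=
  ((Finset.univ.filter fun i => wperm σ w i ≠ wperm σ v i).card : ℝ) / N

lemma dis_nonneg {N : ℕ} (σ : Fin s → Equiv.Perm (Fin N)) (w v : List (Fin s × Bool)) :
    0 ≤ dis σ w v := by
  unfold dis; positivity

lemma dis_self {N : ℕ} (σ : Fin s → Equiv.Perm (Fin N)) (w : List (Fin s × Bool)) :
    dis σ w w = 0 := by
  simp [dis]

lemma dis_symm {N : ℕ} (σ : Fin s → Equiv.Perm (Fin N)) (w v : List (Fin s × Bool)) :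
    dis σ w v = dis σ v w := by
  simp only [dis, ne_comm]

lemma dis_trans {N : ℕ} (σ : Fin s → Equiv.Perm (Fin N)) (w v u : List (Fin s × Bool)) :
    dis σ w u ≤ dis σ w v + dis σ v u := by
  simp only [dis]
  rw [← add_div]
  refine div_le_div_of_nonneg_right ?_ (Nat.cast_nonneg _)
  norm_cast
  refine le_trans (Finset.card_le_card ?_) (Finset.card_union_le _ _)
  intro i
  simp only [Finset.mem_filter, Finset.mem_univ, true_and, Finset.mem_union]
  intro h
  by_contra! hc
  exact h (hc.1.trans hc.2)

lemma dis_mul {N : ℕ} (σ : Fin s → Equiv.Perm (Fin N)) (w₁ w₂ v₁ v₂ : List (Fin s × Bool)) :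
    dis σ (w₁ ++ v₁) (w₂ ++ v₂) ≤ dis σ w₁ w₂ + dis σ v₁ v₂ := by
  simp only [dis]
  rw [← add_div]
  refine div_le_div_of_nonneg_right ?_ (Nat.cast_nonneg _)
  norm_cast
  rw [← Finset.card_map (s := Finset.univ.filter fun i => wperm σ w₁ i ≠ wperm σ w₂ i)
    (wperm σ v₁)⁻¹.toEmbedding]
  refine le_trans (Finset.card_le_card ?_) (Finset.card_union_le _ _)
  intro i
  simp only [Finset.mem_filter, Finset.mem_univ, true_and, Finset.mem_union, Finset.mem_map,
    wperm_append, Equiv.Perm.mul_apply, Equiv.coe_toEmbedding]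
  intro h
  by_contra! hc
  apply h
  rw [← hc.2]
  by_contra hne
  exact hc.1 (wperm σ v₁ i) hne ((Equiv.Perm.inv_eq_iff_eq).2 rfl)

lemma nfix_le_dis {N : ℕ} (σ : Fin s → Equiv.Perm (Fin N)) (w v : List (Fin s × Bool)) :
    (nfix (wperm σ w) : ℝ) / N ≤ dis σ w v + (nfix (wperm σ v) : ℝ) / N := by
  simp only [dis, nfix]
  rw [← add_div]
  refine div_le_div_of_nonneg_right ?_ (Nat.cast_nonneg _)
  norm_cast
  refine le_trans (Finset.card_le_card ?_) (Finset.card_union_le _ _)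
  intro i
  simp only [Finset.mem_filter, Finset.mem_univ, true_and, Finset.mem_union]
  intro h
  by_contra! hc
  exact hc.2 (hc.1.symm.trans h)

lemma nfix_add_dis {N : ℕ} (hN : 0 < N) (σ : Fin s → Equiv.Perm (Fin N))
    (w : List (Fin s × Bool)) : (nfix (wperm σ w) : ℝ) / N = 1 - dis σ w [] := by
  have hN' : (N : ℝ) ≠ 0 := by exact_mod_cast hN.ne'
  have h := Finset.card_filter_add_card_filter_not (s := (Finset.univ : Finset (Fin N)))
    (fun i => wperm σ w i = i)
  rw [Finset.card_univ, Fintype.card_fin] at h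
  have h' : ((Finset.univ.filter fun i => wperm σ w i = i).card : ℝ) +
    (Finset.univ.filter fun i => ¬ wperm σ w i = i).card = N := by exact_mod_cast h
  simp only [dis, nfix, wperm_nil, Equiv.Perm.one_apply, ne_eq]
  field_simp
  linarith

lemma card_le_sum_nper {N : ℕ} (σ : Equiv.Perm (Fin N)) (T : Finset ℕ) (F : Finset (Fin N))
    (h : ∀ i ∈ F, Function.minimalPeriod (⇑σ) i ∈ T) : F.card ≤ ∑ k ∈ T, nper σ k := by
  rw [Finset.card_eq_sum_card_fiberwise (f := fun i => Function.minimalPeriod (⇑σ) i) (t := T) h]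
  refine Finset.sum_le_sum fun k _ => Finset.card_le_card ?_
  intro i
  simp only [Finset.mem_filter, Finset.mem_univ, true_and]
  exact fun h => h.2

open Classical in
/-- the admissible periods different from `d` -/
def goodK (A : Set ℕ) (d : ℕ∞) (n : ℕ) : Finset ℕ :=
  (Finset.range (n + 1)).filter fun k => k ∈ A ∧ (k : ℕ∞) ≠ d

lemma mem_goodK {A : Set ℕ} {d : ℕ∞} {n k : ℕ} :
    k ∈ goodK A d n ↔ k ≤ n ∧ k ∈ A ∧ (k : ℕ∞) ≠ d := by
  simp [goodK, Nat.lt_succ_iff]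

lemma nfix_zpow_le {N : ℕ} (A : Set ℕ) (d : ℕ∞) (σ : Equiv.Perm (Fin N))
    (hσ : σ ∈ permF (Fin N) A) (m : ℤ) (hm : ¬ ((d.toNat : ℕ) : ℤ) ∣ m) :
    nfix (σ ^ m) ≤ ∑ k ∈ goodK A d m.natAbs, nper σ k := by
  refine card_le_sum_nper σ _ _ fun i hi => ?_
  have hi' : (σ ^ m) i = i := by simpa using hi
  have hper : (σ ^ m.natAbs) i = i := by
    rcases Int.natAbs_eq m with h | h
    · rw [h, zpow_natCast] at hi'
      exact hi'
    · rw [h, zpow_neg, zpow_natCast] at hi'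
      exact (Equiv.Perm.inv_eq_iff_eq.1 hi').symm
  rw [← minimalPeriod_dvd_iff] at hper
  have hm0 : m.natAbs ≠ 0 := by
    intro h
    rw [Int.natAbs_eq_zero] at h
    exact hm (h ▸ dvd_zero _)
  refine mem_goodK.2 ⟨Nat.le_of_dvd (Nat.pos_of_ne_zero hm0) hper, mem_permF.1 hσ i, ?_⟩
  intro h
  apply hm
  rw [← h, ENat.toNat_natCast]
  exact Int.natCast_dvd.2 hper

lemma wperm_replicate_true {α : Type*} (σ : Fin s → Equiv.Perm α) (r : Fin s) (m : ℕ) :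
    wperm σ (List.replicate m (r, true)) = σ r ^ m := by
  simp [wperm]

lemma wperm_replicate_false {α : Type*} (σ : Fin s → Equiv.Perm α) (r : Fin s) (m : ℕ) :
    wperm σ (List.replicate m (r, false)) = (σ r ^ m)⁻¹ := by
  simp [wperm]

lemma npow_le {N : ℕ} (A : Set ℕ) (m : ℕ) (hA : ∀ k ∈ A, (k : ℕ∞) ≤ m) (σ : Equiv.Perm (Fin N))
    (hσ : σ ∈ permF (Fin N) A) (F : Finset (Fin N)) (hF : ∀ i ∈ F, (σ ^ m) i ≠ i) :
    F.card ≤ ∑ k ∈ goodK A m m, nper σ k := by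
  refine card_le_sum_nper σ _ _ fun i hi => ?_
  have hA' := mem_permF.1 hσ i
  refine mem_goodK.2 ⟨by exact_mod_cast hA _ hA', hA', ?_⟩
  intro h
  have h' : Function.minimalPeriod (⇑σ) i = m := by exact_mod_cast h
  exact hF i hi ((minimalPeriod_dvd_iff σ i m).1 (dvd_of_eq h'))

/-- all the hypotheses about small sequences -/
structure SmallHyp (S : (ℕ → ℝ) → Prop) (d : Fin s → ℕ∞) (A : Fin s → Set ℕ) (Nk : ℕ → ℕ) :
    Prop where
  cls : SmallClass S
  inv : S fun j => (1 : ℝ) / Nk j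
  per : ∀ r k, k ∈ A r → (k : ℕ∞) ≠ d r →
    S fun j => av A (Nk j) (fun σ => (nper (σ r) k : ℝ) / Nk j)

variable {S : (ℕ → ℝ) → Prop} {d : Fin s → ℕ∞} {A : Fin s → Set ℕ} {Nk : ℕ → ℕ}

lemma SmallHyp.sumper (H : SmallHyp S d A Nk) (r : Fin s) (n : ℕ) :
    S fun j => av A (Nk j) (fun σ => ((∑ k ∈ goodK (A r) (d r) n, nper (σ r) k : ℕ) : ℝ) / Nk j) := by
  simp only [Nat.cast_sum, Finset.sum_div, av_sum]
  refine H.cls.sum _ _ fun k hk => ?_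
  have := mem_goodK.1 hk
  exact H.per r k this.2.1 this.2.2

lemma SmallHyp.dis (H : SmallHyp S d A Nk) (hA : ∀ r, ∀ m ∈ A r, (m : ℕ∞) ≤ d r)
    {w₁ w₂ : List (Fin s × Bool)} (h : WordEquiv s d w₁ w₂) :
    S fun j => av A (Nk j) (fun σ => dis σ w₁ w₂) := by
  induction h with
  | of h =>
    cases h with
    | cancel₁ r =>
      have : ∀ j, av A (Nk j) (fun σ => _root_.dis σ [(r, true), (r, false)] []) = 0 := by
        intro j
        rw [← av_zero A (Nk j)]
        congr 1
        funext σ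
        simp [_root_.dis, wperm]
      simp only [this]
      exact H.cls.zero
    | cancel₂ r =>
      have : ∀ j, av A (Nk j) (fun σ => _root_.dis σ [(r, false), (r, true)] []) = 0 := by
        intro j
        rw [← av_zero A (Nk j)]
        congr 1
        funext σ
        simp [_root_.dis, wperm]
      simp only [this]
      exact H.cls.zero
    | power₁ r m h =>
      refine H.cls.dom _ _ (Eventually.of_forall fun j => ⟨av_nonneg fun σ _ => dis_nonneg _ _ _,
        av_mono fun σ hσ => ?_⟩) (H.sumper r m)
      refine div_le_div_of_nonneg_right ?_ (Nat.cast_nonneg _)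
      rw [Nat.cast_le, h]
      refine npow_le (A r) m (fun k hk => h ▸ hA r k hk) (σ r) (mem_Om.1 hσ r) _ fun i hi => ?_
      rw [Finset.mem_filter, wperm_replicate_true, wperm_nil] at hi
      exact hi.2
    | power₂ r m h =>
      refine H.cls.dom _ _ (Eventually.of_forall fun j => ⟨av_nonneg fun σ _ => dis_nonneg _ _ _,
        av_mono fun σ hσ => ?_⟩) (H.sumper r m)
      refine div_le_div_of_nonneg_right ?_ (Nat.cast_nonneg _)
      rw [Nat.cast_le, h]
      refine npow_le (A r) m (fun k hk => h ▸ hA r k hk) (σ r) (mem_Om.1 hσ r) _ fun i hi => ?_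
      rw [Finset.mem_filter, wperm_replicate_false, wperm_nil] at hi
      intro h'
      exact hi.2 (Equiv.Perm.inv_eq_iff_eq.2 h'.symm)
  | refl w =>
    simp only [dis_self, av_zero]
    exact H.cls.zero
  | symm _ ih =>
    simpa only [dis_symm] using ih
  | @trans w₁ w₂ w₃ _ _ ih₁ ih₂ =>
    refine H.cls.dom _ _ (Eventually.of_forall fun j => ⟨av_nonneg fun σ _ => dis_nonneg _ _ _, ?_⟩)
      (H.cls.add _ _ ih₁ ih₂)
    rw [← av_add]
    exact av_mono fun σ _ => dis_trans σ _ _ _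
  | mul _ _ ih₁ ih₂ =>
    refine H.cls.dom _ _ (Eventually.of_forall fun j => ⟨av_nonneg fun σ _ => dis_nonneg _ _ _, ?_⟩)
      (H.cls.add _ _ ih₁ ih₂)
    rw [← av_add]
    exact av_mono fun σ _ => dis_mul σ _ _ _ _

end words

section reduced
variable {s : ℕ} {d : Fin s → ℕ∞}

/-- power of a letter -/
def pw (r : Fin s) (m : ℤ) : List (Fin s × Bool) :=
  if 0 ≤ m then List.replicate m.toNat (r, true) else List.replicate (-m).toNat (r, false)

lemma pw_nat (r : Fin s) (n : ℕ) : pw r n = List.replicate n (r, true) := by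
  simp [pw]

lemma pw_neg_nat (r : Fin s) (n : ℕ) : pw r (-n) = List.replicate n (r, false) := by
  rcases Nat.eq_zero_or_pos n with h | h
  · subst h; simp [pw]
  · have : ¬ (0 : ℤ) ≤ -n := by omega
    simp [pw]

lemma wperm_pw {α : Type*} (σ : Fin s → Equiv.Perm α) (r : Fin s) (m : ℤ) :
    wperm σ (pw r m) = σ r ^ m := by
  obtain ⟨n, rfl | rfl⟩ := m.eq_nat_or_neg
  · rw [pw_nat, wperm_replicate_true, zpow_natCast]
  · rw [pw_neg_nat, wperm_replicate_false, zpow_neg, zpow_natCast]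

lemma pw_succ (r : Fin s) (m : ℤ) : WordEquiv s d ((r, true) :: pw r m) (pw r (m + 1)) := by
  obtain ⟨n, rfl | rfl⟩ := m.eq_nat_or_neg
  · rw [pw_nat, ← List.replicate_succ, show (n : ℤ) + 1 = ((n + 1 : ℕ) : ℤ) by push_cast; rfl,
      pw_nat]
    exact .refl _
  · cases n with
    | zero => simp [pw]; exact .refl _
    | succ n =>
      rw [pw_neg_nat, show (-((n + 1 : ℕ) : ℤ)) + 1 = -(n : ℤ) by push_cast; ring, pw_neg_nat,
        List.replicate_succ]
      exact .mul (w₁ := [(r, true), (r, false)]) (w₂ := []) (.of (.cancel₁ r)) (.refl _)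

lemma pw_pred (r : Fin s) (m : ℤ) : WordEquiv s d ((r, false) :: pw r m) (pw r (m - 1)) := by
  obtain ⟨n, rfl | rfl⟩ := m.eq_nat_or_neg
  · cases n with
    | zero => simp [pw]; exact .refl _
    | succ n =>
      rw [pw_nat, show (((n + 1 : ℕ) : ℤ)) - 1 = (n : ℤ) by push_cast; ring, pw_nat,
        List.replicate_succ]
      exact .mul (w₁ := [(r, false), (r, true)]) (w₂ := []) (.of (.cancel₂ r)) (.refl _)
  · rw [pw_neg_nat, ← List.replicate_succ,
      show -(n : ℤ) - 1 = -((n + 1 : ℕ) : ℤ) by push_cast; ring, pw_neg_nat]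
    exact .refl _

/-- exponent of a letter -/
def lexp (b : Bool) : ℤ := if b then 1 else -1

lemma pw_letter (r : Fin s) (b : Bool) (m : ℤ) :
    WordEquiv s d ((r, b) :: pw r m) (pw r (m + lexp b)) := by
  cases b
  · exact pw_pred r m
  · exact pw_succ r m

lemma replicate_equiv (r : Fin s) (b : Bool) (D : ℕ) (h : WordEquiv s d (List.replicate D (r, b)) [])
    (q : ℕ) : WordEquiv s d (List.replicate (D * q) (r, b)) [] := by
  induction q with
  | zero => simp; exact .refl _
  | succ q ih =>
    rw [Nat.mul_succ, List.replicate_add]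
    exact .mul (w₂ := []) (v₂ := []) ih h

lemma pw_dvd (r : Fin s) (m : ℤ) (h : (((d r).toNat : ℕ) : ℤ) ∣ m) :
    WordEquiv s d (pw r m) [] := by
  by_cases htop : d r = ⊤
  · rw [htop] at h
    simp at h
    subst h
    simp [pw]
    exact .refl _
  · have hd : d r = (((d r).toNat : ℕ) : ℕ∞) := (ENat.natCast_toNat htop).symm
    have h2 := Int.natCast_dvd.1 h
    obtain ⟨q, hq⟩ := h2
    rcases Int.natAbs_eq m with h | h
    · rw [h, pw_nat, hq]
      exact replicate_equiv r true _ (.of (.power₁ r _ hd)) q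
    · rw [h, pw_neg_nat, hq]
      exact replicate_equiv r false _ (.of (.power₂ r _ hd)) q

/-- word of a block list -/
def toWord : List (Fin s × ℤ) → List (Fin s × Bool)
  | [] => []
  | b :: bs => pw b.1 b.2 ++ toWord bs

/-- reduced block lists -/
def Red (d : Fin s → ℕ∞) (bs : List (Fin s × ℤ)) : Prop :=
  List.IsChain (fun a b => a.1 ≠ b.1) bs ∧ ∀ p ∈ bs, ¬ (((d p.1).toNat : ℕ) : ℤ) ∣ p.2

lemma red_cons (r : Fin s) (m : ℤ) (bs : List (Fin s × ℤ)) (h : Red d bs)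
    (hr : ∀ b ∈ bs.head?, r ≠ b.1) :
    ∃ bs', Red d bs' ∧ WordEquiv s d (pw r m ++ toWord bs) (toWord bs') := by
  by_cases hm : (((d r).toNat : ℕ) : ℤ) ∣ m
  · exact ⟨bs, h, .mul (w₂ := []) (pw_dvd r m hm) (.refl _)⟩
  · refine ⟨(r, m) :: bs, ⟨?_, ?_⟩, .refl _⟩
    · rw [List.isChain_cons]
      exact ⟨fun b hb => hr b hb, h.1⟩
    · intro p hp
      rcases List.mem_cons.1 hp with rfl | hp
      · exact hm
      · exact h.2 p hp

lemma exists_red (w : List (Fin s × Bool)) : ∃ bs, Red d bs ∧ WordEquiv s d w (toWord bs) := by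
  induction w with
  | nil => exact ⟨[], ⟨by simp, by simp⟩, .refl _⟩
  | cons l w ih =>
    obtain ⟨r, b⟩ := l
    obtain ⟨bs, h, hw⟩ := ih
    have h1 : WordEquiv s d ((r, b) :: w) ((r, b) :: toWord bs) :=
      .mul (w₁ := [(r, b)]) (w₂ := [(r, b)]) (.refl _) hw
    have key : ∀ (m : ℤ) (bs' : List (Fin s × ℤ)), Red d bs' → (∀ b ∈ bs'.head?, r ≠ b.1) →
        toWord bs = pw r m ++ toWord bs' →
        ∃ bs, Red d bs ∧ WordEquiv s d ((r, b) :: w) (toWord bs) := by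
      intro m bs' hbs' hr he
      obtain ⟨bs'', h2, h3⟩ := red_cons r (m + lexp b) bs' hbs' hr
      refine ⟨bs'', h2, h1.trans (.trans ?_ h3)⟩
      rw [he]
      exact .mul (w₁ := (r, b) :: pw r m) (pw_letter r b m) (.refl _)
    cases bs with
    | nil => exact key 0 [] h (by simp) (by simp [pw, toWord])
    | cons c bs =>
      by_cases hc : r = c.1
      · refine key c.2 bs ⟨h.1.tail, fun p hp => h.2 p (List.mem_cons_of_mem _ hp)⟩ ?_ ?_
        · have := (List.isChain_cons.1 h.1).1
          intro b hb
          rw [hc]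
          exact this b hb
        · rw [hc]; rfl
      · refine key 0 (c :: bs) h ?_ (by simp [pw])
        intro b hb
        simp at hb
        rw [← hb]
        exact hc

/-- negate all exponents -/
def negB (bs : List (Fin s × ℤ)) : List (Fin s × ℤ) := bs.map fun p => (p.1, -p.2)

lemma negB_red {bs : List (Fin s × ℤ)} (h : Red d bs) : Red d (negB bs) := by
  refine ⟨?_, ?_⟩
  · rw [negB, List.isChain_map]
    exact h.1
  · intro p hp
    obtain ⟨q, hq, rfl⟩ := List.mem_map.1 hp
    simpa using h.2 q hq

lemma blockPath_negB {α : Type*} (σ : Fin s → Equiv.Perm α) (bs : List (Fin s × ℤ)) (y : α) :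
    blockPath σ (negB bs) (wperm σ (toWord bs) y) = y := by
  induction bs with
  | nil => simp [negB, toWord, wperm, blockPath]
  | cons c bs ih =>
    have : negB (c :: bs) = (c.1, -c.2) :: negB bs := rfl
    rw [this, toWord, wperm_append, wperm_pw, blockPath, Equiv.Perm.mul_apply]
    have h2 : (σ c.1 ^ (-c.2)) ((σ c.1 ^ c.2) ((wperm σ (toWord bs)) y)) =
        (wperm σ (toWord bs)) y := by
      rw [← Equiv.Perm.mul_apply, ← zpow_add]
      simp
    rw [h2, ih]

lemma av_toWord (A : Fin s → Set ℕ) (N : ℕ) (hN : 0 < N) (b : Fin s × ℤ) (bs : List (Fin s × ℤ))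
    (h : List.IsChain (fun a b => a.1 ≠ b.1) (b :: bs)) (M : ℕ) (hM : 2 * (b :: bs).length ≤ M)
    (hMN : 2 * M ≤ N) :
    ∑ σ ∈ Om A N, ∑ y : Fin N, (if blockPath σ (b :: bs) y = y then (1 : ℝ) else 0) ≤
      ∑ σ ∈ Om A N, N * ((b :: bs).map fun c =>
        (4 * M + 2 * nfix (σ c.1 ^ c.2) : ℝ) / N).sum := by
  have hT : (0 : ℝ) < Fintype.card (Fin s → Equiv.Perm (Fin N)) := by
    exact_mod_cast Fintype.card_pos
  refine le_of_mul_le_mul_left ?_ hT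
  have e1 : (Fintype.card (Fin s → Equiv.Perm (Fin N)) : ℝ) *
      ∑ σ ∈ Om A N, ∑ y : Fin N, (if blockPath σ (b :: bs) y = y then (1 : ℝ) else 0) =
      ∑ σ ∈ Om A N, ∑ y : Fin N, ((Finset.univ.filter fun τ : Fin s → Equiv.Perm (Fin N) =>
        blockPath (conjT τ σ) (b :: bs) y = y).card : ℝ) := by
    have : (Fintype.card (Fin s → Equiv.Perm (Fin N)) : ℝ) *
      ∑ σ ∈ Om A N, ∑ y : Fin N, (if blockPath σ (b :: bs) y = y then (1 : ℝ) else 0) =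
      ∑ τ : Fin s → Equiv.Perm (Fin N), ∑ σ ∈ Om A N, ∑ y : Fin N,
        (if blockPath (conjT τ σ) (b :: bs) y = y then (1 : ℝ) else 0) := by
      rw [← Finset.card_univ, ← nsmul_eq_mul, ← Finset.sum_const]
      refine Finset.sum_congr rfl fun τ _ => ?_
      exact (sum_conj A N τ (fun σ => ∑ y : Fin N,
        (if blockPath σ (b :: bs) y = y then (1 : ℝ) else 0))).symm
    rw [this, Finset.sum_comm]
    refine Finset.sum_congr rfl fun σ _ => ?_
    rw [Finset.sum_comm]
    refine Finset.sum_congr rfl fun y _ => ?_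
    rw [Finset.sum_boole]
  rw [e1, Finset.mul_sum]
  refine Finset.sum_le_sum fun σ _ => ?_
  have hex : ∀ y : Fin N, ((Finset.univ.filter fun τ : Fin s → Equiv.Perm (Fin N) =>
        blockPath (conjT τ σ) (b :: bs) y = y).card : ℝ) ≤ ((b :: bs).map fun c =>
        (4 * M + 2 * nfix (σ c.1 ^ c.2) : ℝ) / N).sum *
          Fintype.card (Fin s → Equiv.Perm (Fin N)) := by
    intro y
    have := explore σ M (by simpa using hMN) (by simpa using hN) y bs b h ∅ y (by simpa using hM)
      (by simp) (Or.inl rfl)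
    have hT0 : (Tset (∅ : Finset (Fin s × Fin N × Fin N))) = Finset.univ := by
      ext; simp [mem_Tset]
    rw [hT0, Finset.card_univ, Fintype.card_fin] at this
    exact this
  refine (Finset.sum_le_sum fun y _ => hex y).trans (le_of_eq ?_)
  rw [Finset.sum_const, Finset.card_univ, Fintype.card_fin, nsmul_eq_mul]
  ring

variable {S : (ℕ → ℝ) → Prop} {A : Fin s → Set ℕ} {Nk : ℕ → ℕ}

lemma SmallHyp.blocks (H : SmallHyp S d A Nk) (M : ℕ) (bs : List (Fin s × ℤ))
    (h : ∀ p ∈ bs, ¬ (((d p.1).toNat : ℕ) : ℤ) ∣ p.2) :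
    S fun j => av A (Nk j) (fun σ => (bs.map fun c =>
        (4 * M + 2 * nfix (σ c.1 ^ c.2) : ℝ) / Nk j).sum) := by
  induction bs with
  | nil =>
    simp only [List.map_nil, List.sum_nil, av_zero]
    exact H.cls.zero
  | cons c bs ih =>
    simp only [List.map_cons, List.sum_cons, av_add]
    refine H.cls.add _ _ ?_ (ih fun p hp => h p (List.mem_cons_of_mem _ hp))
    refine H.cls.dom _ _ (Eventually.of_forall fun j =>
      ⟨av_nonneg fun σ _ => by positivity, ?_⟩)
      (H.cls.add _ _ (H.cls.cmul (4 * M) _ H.inv)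
        (H.cls.cmul 2 _ (H.sumper c.1 c.2.natAbs)))
    have h1 := av_const_le A (Nk j) (4 * M * (1 / Nk j)) (by positivity)
    refine le_trans ?_ (add_le_add h1 le_rfl)
    rw [← av_cmul, ← av_add]
    refine av_mono fun σ hσ => ?_
    have h2 := nfix_zpow_le (A c.1) (d c.1) (σ c.1) (mem_Om.1 hσ c.1) c.2
      (h c List.mem_cons_self)
    have h3 : (nfix (σ c.1 ^ c.2) : ℝ) ≤
      ((∑ k ∈ goodK (A c.1) (d c.1) c.2.natAbs, nper (σ c.1) k : ℕ) : ℝ) := by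
      exact_mod_cast h2
    have h4 := div_le_div_of_nonneg_right h3 (Nat.cast_nonneg (Nk j) : (0 : ℝ) ≤ Nk j)
    rw [add_div, mul_div_assoc, mul_div_assoc]
    rw [mul_one_div]
    linarith [mul_div_assoc (4 : ℝ) M (Nk j)]

lemma SmallHyp.toWord (H : SmallHyp S d A Nk) (hmono : StrictMono Nk) (bs : List (Fin s × ℤ))
    (hbs : bs ≠ []) (h : Red d bs) :
    S fun j => av A (Nk j) (fun σ => (nfix (wperm σ (toWord bs)) : ℝ) / Nk j) := by
  set M := 2 * (negB bs).length with hM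
  have hr := negB_red h
  refine H.cls.dom _ _ ?_ (H.blocks M (negB bs) hr.2)
  filter_upwards [eventually_ge_atTop (2 * M + 1)] with j hj
  have hjN : j ≤ Nk j := hmono.id_le j
  have hN : (0 : ℝ) < Nk j := by
    have : 0 < Nk j := by omega
    exact_mod_cast this
  refine ⟨av_nonneg fun σ _ => by positivity, ?_⟩
  have hb : negB bs ≠ [] := by simpa [negB] using hbs
  obtain ⟨b, l, hbl⟩ := List.exists_cons_of_ne_nil hb
  have key := av_toWord A (Nk j) (by omega) b l (hbl ▸ hr.1) M (by rw [hM, hbl]) (by omega)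
  rw [← hbl, ← Finset.mul_sum] at key
  refine div_le_div_of_nonneg_right ?_ (Nat.cast_nonneg _)
  rw [← Finset.sum_div, div_le_iff₀ hN, mul_comm]
  refine le_trans (Finset.sum_le_sum fun σ _ => ?_) key
  rw [Finset.sum_boole, nfix, Nat.cast_le]
  refine Finset.card_le_card ?_
  intro i
  simp only [Finset.mem_filter, Finset.mem_univ, true_and]
  intro hi
  have := blockPath_negB σ bs i
  rwa [hi] at this

lemma SmallHyp.word (H : SmallHyp S d A Nk) (hA : ∀ r, ∀ m ∈ A r, (m : ℕ∞) ≤ d r)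
    (hmono : StrictMono Nk) (w : List (Fin s × Bool)) (hw : ¬ WordEquiv s d w []) :
    S fun j => av A (Nk j) (fun σ => (nfix (wperm σ w) : ℝ) / Nk j) := by
  obtain ⟨bs, hr, he⟩ := exists_red (d := d) w
  have hbs : bs ≠ [] := by
    rintro rfl
    exact hw he
  refine H.cls.dom _ _ (Eventually.of_forall fun j => ⟨av_nonneg fun σ _ => by positivity, ?_⟩)
    (H.cls.add _ _ (H.dis hA he) (H.toWord hmono bs hbs hr))
  rw [← av_add]
  exact av_mono fun σ _ => nfix_le_dis σ _ _

end reduced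

section final
variable {s : ℕ}

lemma permMat_mul {N : ℕ} (p q : Equiv.Perm (Fin N)) :
    permMat N (p * q) = permMat N p * permMat N q := by
  ext i j
  simp only [permMat, Matrix.mul_apply, Matrix.of_apply, Equiv.Perm.mul_apply]
  rw [Finset.sum_eq_single (q j)]
  · by_cases h : p (q j) = i <;> simp [h]
  · intro b _ hb
    simp [Ne.symm hb]
  · simp

lemma permMat_one {N : ℕ} : permMat N 1 = 1 := by
  ext i j
  simp [permMat, Matrix.one_apply, eq_comm]

lemma Uword_eq {N : ℕ} (σ : Fin s → Equiv.Perm (Fin N)) (w : List (Fin s × Bool)) :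
    Uword N σ w = permMat N (wperm σ w) := by
  induction w with
  | nil => simp [Uword, wperm, permMat_one]
  | cons l w ih =>
    have h1 : Uword N σ (l :: w) =
      (if l.2 then permMat N (σ l.1) else permMat N ((σ l.1)⁻¹)) * Uword N σ w := by
      simp [Uword]
    have h2 : wperm σ (l :: w) = (if l.2 then σ l.1 else (σ l.1)⁻¹) * wperm σ w := by
      simp [wperm]
    rw [h1, h2, ih, permMat_mul]
    split_ifs <;> rfl

lemma ntr_eq {N : ℕ} (σ : Fin s → Equiv.Perm (Fin N)) (w : List (Fin s × Bool)) :
    ntr (Uword N σ w) = (((nfix (wperm σ w) : ℝ) / N : ℝ) : ℂ) := by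
  rw [Uword_eq, ntr, Matrix.trace]
  simp [permMat, Matrix.diag, nfix, Finset.sum_boole]

lemma mem_permSet_iff {N : ℕ} (A : Set ℕ) (σ : Equiv.Perm (Fin N)) :
    σ ∈ permSet A N ↔ σ ∈ permF (Fin N) A := by
  rw [mem_permF]; rfl

lemma card_permSet (A : Set ℕ) (N : ℕ) :
    Nat.card ↥(permSet A N) = (permF (Fin N) A).card := by
  have : permSet A N = ↑(permF (Fin N) A) := by
    ext σ; rw [mem_permSet_iff]; rfl
  rw [this]
  simp

lemma EE_eq (A : Fin s → Set ℕ) (N : ℕ) (f : (Fin s → Equiv.Perm (Fin N)) → ℝ) :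
    EE A N (fun σ => ((f σ : ℝ) : ℂ)) = ((av A N f : ℝ) : ℂ) := by
  classical
  rw [EE, av, Complex.ofReal_div]
  congr 1
  · rw [finsum_eq_sum_of_fintype, Complex.ofReal_sum]
    rw [Finset.sum_subtype (Om A N) (p := fun σ => ∀ r, σ r ∈ permSet (A r) N)]
    intro σ
    simp only [mem_Om, mem_permSet_iff]
  · rw [Om, Fintype.card_piFinset]
    push_cast
    simp only [card_permSet]

lemma EE_prod (A : Fin s → Set ℕ) (N n : ℕ) (w : Fin n → List (Fin s × Bool)) :
    EE A N (fun σ => ∏ a, ntr (Uword N σ (w a))) =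
      ((av A N (fun σ => ∏ a, (nfix (wperm σ (w a)) : ℝ) / N) : ℝ) : ℂ) := by
  rw [← EE_eq]
  congr 1
  funext σ
  simp only [ntr_eq, Complex.ofReal_prod]

lemma nfix_div_le_one {N : ℕ} (p : Equiv.Perm (Fin N)) : (nfix p : ℝ) / N ≤ 1 := by
  refine div_le_one_of_le₀ ?_ (Nat.cast_nonneg _)
  have : nfix p ≤ N := by
    have := Finset.card_filter_le (Finset.univ : Finset (Fin N)) (fun i => p i = i)
    rwa [Finset.card_univ, Fintype.card_fin] at this
  exact_mod_cast this

lemma one_sub_prod_le {n : ℕ} (T : Finset (Fin n)) (x : Fin n → ℝ)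
    (h0 : ∀ a, 0 ≤ x a) (h1 : ∀ a, x a ≤ 1) :
    1 - ∏ a ∈ T, (1 - x a) ≤ ∑ a ∈ T, x a := by
  induction T using Finset.induction_on with
  | empty => simp
  | insert a T ha ih =>
    rw [Finset.prod_insert ha, Finset.sum_insert ha]
    have hp : ∏ a ∈ T, (1 - x a) ≤ 1 :=
      Finset.prod_le_one (fun b _ => sub_nonneg.2 (h1 b)) fun b _ => by linarith [h0 b]
    nlinarith [h0 a, h1 a, mul_le_mul_of_nonneg_left hp (h0 a)]

variable {S : (ℕ → ℝ) → Prop} {d : Fin s → ℕ∞} {A : Fin s → Set ℕ} {Nk : ℕ → ℕ}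

lemma SmallHyp.bad (H : SmallHyp S d A Nk) (hA : ∀ r, ∀ m ∈ A r, (m : ℕ∞) ≤ d r)
    (hmono : StrictMono Nk) {n : ℕ} (w : Fin n → List (Fin s × Bool))
    (hw : ¬ ∀ a, WordEquiv s d (w a) []) :
    S fun j => av A (Nk j) (fun σ => ∏ a, (nfix (wperm σ (w a)) : ℝ) / Nk j) := by
  push Not at hw
  obtain ⟨a, ha⟩ := hw
  refine H.cls.dom _ _ (Eventually.of_forall fun j => ⟨av_nonneg fun σ _ =>
    Finset.prod_nonneg fun _ _ => by positivity, av_mono fun σ _ => ?_⟩) (H.word hA hmono (w a) ha)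
  rw [← Finset.mul_prod_erase _ _ (Finset.mem_univ a)]
  exact mul_le_of_le_one_right (by positivity)
    (Finset.prod_le_one (fun _ _ => by positivity) fun _ _ => nfix_div_le_one _)

lemma SmallHyp.good (H : SmallHyp S d A Nk) (hA : ∀ r, ∀ m ∈ A r, (m : ℕ∞) ≤ d r)
    (hpos : ∀ j, 0 < Nk j)
    (hne : ∀ j r, (permF (Fin (Nk j)) (A r)).Nonempty) {n : ℕ} (w : Fin n → List (Fin s × Bool))
    (hw : ∀ a, WordEquiv s d (w a) []) :
    S fun j => 1 - av A (Nk j) (fun σ => ∏ a, (nfix (wperm σ (w a)) : ℝ) / Nk j) := by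
  refine H.cls.dom _ _ (Eventually.of_forall fun j => ?_)
    (H.cls.sum Finset.univ _ fun a _ => H.dis hA (hw a))
  have hc := av_const A (Nk j) (Om_nonempty (hne j)) 1
  constructor
  · rw [sub_nonneg]
    refine le_trans (av_mono (g := fun _ => 1) fun σ _ => ?_) hc.le
    exact Finset.prod_le_one (fun _ _ => by positivity) fun _ _ => nfix_div_le_one _
  · rw [← av_sum, sub_le_iff_le_add, ← av_add, ← hc]
    refine av_mono fun σ _ => ?_
    simp only [nfix_add_dis (hpos j)]
    have := one_sub_prod_le Finset.univ (fun a => _root_.dis σ (w a) [])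
      (fun a => dis_nonneg _ _ _) (fun a => by
        have h := nfix_add_dis (hpos j) σ (w a)
        have h' : (0 : ℝ) ≤ (nfix (wperm σ (w a)) : ℝ) / Nk j := by positivity
        linarith)
    linarith

end final

/-- Along an increasing sequence `N_k` with `S_{N_k}^{(A_r)} ≠ ∅`, the expectation
`E_k[Π_a tr U_{w_a}]` tends to `1` if `w_a ≈ e` for all `a`, and to `0` otherwise;
moreover if each `A_r` is a singleton or infinite and not all `w_a ≈ e`, then
`E_k[Π_a tr U_{w_a}] = O(1/N_k)`. -/
theorem expectation_trace_product_limit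
    (s : ℕ) (hs : 0 < s) (d : Fin s → ℕ∞) (hd : ∀ r, 1 ≤ d r)
    (A : Fin s → Set ℕ)
    (hAne : ∀ r, (A r).Nonempty) (hApos : ∀ r, ∀ m ∈ A r, 0 < m)
    (hAsup : ∀ r, (∀ m ∈ A r, (m : ℕ∞) ≤ d r) ∧
      ∀ e : ℕ∞, (∀ m ∈ A r, (m : ℕ∞) ≤ e) → d r ≤ e)
    (hAcond : ∀ r, (A r).Finite ∨
      Summable (((A r)ᶜ : Set ℕ).indicator fun j => (1 : ℝ) / j))
    (Nk : ℕ → ℕ) (hmono : StrictMono Nk) (hNpos : ∀ k, 0 < Nk k)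
    (hSne : ∀ k r, (permSet (A r) (Nk k)).Nonempty)
    (n : ℕ) (hn : 0 < n) (w : Fin n → List (Fin s × Bool)) :
    ((∀ a, WordEquiv s d (w a) []) →
      Tendsto (fun k => EE A (Nk k) fun σ => ∏ a, ntr (Uword (Nk k) σ (w a)))
        atTop (𝓝 1)) ∧
    ((¬ ∀ a, WordEquiv s d (w a) []) →
      Tendsto (fun k => EE A (Nk k) fun σ => ∏ a, ntr (Uword (Nk k) σ (w a)))
        atTop (𝓝 0)) ∧
    ((∀ r, (∃ m : ℕ, A r = {m}) ∨ (A r).Infinite) →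
      (¬ ∀ a, WordEquiv s d (w a) []) →
      (fun k => EE A (Nk k) fun σ => ∏ a, ntr (Uword (Nk k) σ (w a)))
        =O[atTop] fun k => (1 : ℝ) / (Nk k : ℝ)) := by
  have hA := fun r => (hAsup r).1
  have hne : ∀ j r, (permF (Fin (Nk j)) (A r)).Nonempty := fun j r => by
    obtain ⟨σ, hσ⟩ := hSne j r
    exact ⟨σ, (mem_permSet_iff _ _).1 hσ⟩
  have H0 : SmallHyp (fun f => Tendsto f atTop (𝓝 0)) d A Nk := by
    refine ⟨smallClass_tendsto, inv_Nk_tendsto Nk hmono, fun r k hk hkd => ?_⟩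
    by_cases hfin : (A r).Finite
    · obtain ⟨D, hD, hmax⟩ := Set.exists_max_image (A r) id hfin (hAne r)
      have h1 : d r = D := by
        refine le_antisymm ((hAsup r).2 D fun m hm => ?_) (hA r D hD)
        exact_mod_cast hmax m hm
      have h2 : k ≤ D := hmax k hk
      have h3 : k ≠ D := by
        rintro rfl
        exact hkd h1.symm
      exact finite_nper A Nk hmono hne r k D (hApos r k hk) hk hD (by omega)
    · exact (infinite_nper A Nk hmono hne r k (hApos r k hk) hk
        ((hAcond r).resolve_left hfin)).trans_tendsto (inv_Nk_tendsto Nk hmono)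
  refine ⟨fun hw => ?_, fun hw => ?_, fun hsp hw => ?_⟩
  · have h := H0.good hA hNpos hne w hw
    simp only [EE_prod]
    have h2 : Tendsto (fun j => av A (Nk j)
        (fun σ => ∏ a, (nfix (wperm σ (w a)) : ℝ) / Nk j)) atTop (𝓝 1) := by
      have := (tendsto_const_nhds (x := (1 : ℝ))).sub h
      simpa using this
    exact_mod_cast (Complex.continuous_ofReal.tendsto 1).comp h2
  · have h := H0.bad hA hmono w hw
    simp only [EE_prod]
    exact_mod_cast (Complex.continuous_ofReal.tendsto 0).comp h
  · have H1 : SmallHyp (fun f => f =O[atTop] fun k => (1 : ℝ) / (Nk k : ℝ)) d A Nk := by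
      refine ⟨smallClass_bigO _, Asymptotics.isBigO_refl _ _, fun r k hk hkd => ?_⟩
      rcases hsp r with ⟨m, hm⟩ | hinf
      · exfalso
        apply hkd
        refine le_antisymm (hA r k hk) ((hAsup r).2 k fun m' hm' => ?_)
        rw [hm, Set.mem_singleton_iff] at hk hm'
        rw [hk, hm']
      · exact infinite_nper A Nk hmono hne r k (hApos r k hk) hk
          ((hAcond r).resolve_left hinf)
    have h := H1.bad hA hmono w hw
    simp only [EE_prod]
    refine Asymptotics.IsBigO.trans (Asymptotics.IsBigO.of_bound 1 ?_) h
    refine Eventually.of_forall fun j => ?_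
    rw [one_mul, Complex.norm_real]
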